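/- arXiv:2504.10161 — 4 statements merged into one kernel-verified Lean document; each statement's English description precedes it below -/
import Mathlib

section
/- Let A, B, R, T⋆ > 0 and define the Van-der-Waals pressure function P_VdW : [0,B) → ℝ by P_VdW(ρ) = R·T⋆·ρ/(B − ρ) − A·ρ². If γ ≥ 2A, then the artificial pressure function ρ ↦ P_VdW(ρ) + (γ/2)·ρ² is strictly monotonically increasing on [0,B). -/
/-- For the Van-der-Waals pressure `P_VdW(ρ) = R·T⋆·ρ/(B−ρ) − A·ρ²` with `A,B,R,T⋆ > 0`
and a coupling parameter `γ ≥ 2A`, the artificial pressure `ρ ↦ P_VdW(ρ) + (γ/2)·ρ²`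
is strictly monotonically increasing on `[0,B)`. -/
theorem vdw_artificial_pressure_strictMonoOn
    (A B R Tstar γ : ℝ) (hA : 0 < A) (hB : 0 < B) (hR : 0 < R) (hT : 0 < Tstar)
    (hγ : 2 * A ≤ γ) :
    StrictMonoOn (fun ρ : ℝ => (R * Tstar * ρ / (B - ρ) - A * ρ ^ 2) + γ / 2 * ρ ^ 2)
      (Set.Ico 0 B) := by
  rintro x ⟨hx0, hxB⟩ y ⟨_, hyB⟩ hxy
  have hRT : 0 < R * Tstar := mul_pos hR hT
  have hdiv : R * Tstar * x / (B - x) < R * Tstar * y / (B - y) := by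
    rw [div_lt_div_iff₀ (sub_pos.2 hxB) (sub_pos.2 hyB)]
    have hgap : 0 < R * Tstar * (B * (y - x)) :=
      mul_pos hRT (mul_pos hB (sub_pos.2 hxy))
    linarith
  have hsq : (γ / 2 - A) * x ^ 2 ≤ (γ / 2 - A) * y ^ 2 :=
    mul_le_mul_of_nonneg_left (pow_le_pow_left₀ hx0 hxy.le 2) (by linarith)
  dsimp only
  linarith
end

section
/- Let P : [0,∞) → [0,∞) be continuously differentiable with P(0) = 0, and suppose there exist constants β ∈ [2,∞) and a ∈ (0,∞) such that lim_{r→∞} P'(r)/r^{β−1} = a. Let W : [0,∞) → [0,∞) be a pressure potential for P. Then there exists a constant C_ρ > 0 such that r² ≤ C_ρ + C_ρ·W(r) for all r ∈ [0,∞). -/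
open MeasureTheory Filter Set

/-- The `L²` norm of a `1`-periodic function, computed over one period. -/
noncomputable def L2norm (f : ℝ → ℝ) : ℝ := Real.sqrt (∫ x in (0:ℝ)..1, f x ^ 2)

/-- The `H¹` norm of a `1`-periodic function, computed over one period. -/
noncomputable def H1norm (f : ℝ → ℝ) : ℝ :=
  Real.sqrt (∫ x in (0:ℝ)..1, f x ^ 2 + deriv f x ^ 2)

/-- The `H²` norm of a `1`-periodic function, computed over one period. -/
noncomputable def H2norm (f : ℝ → ℝ) : ℝ :=
  Real.sqrt (∫ x in (0:ℝ)..1, f x ^ 2 + deriv f x ^ 2 + deriv (deriv f) x ^ 2)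

/-- The sup-norm of a `1`-periodic function, computed over one period. -/
noncomputable def LinfNorm (f : ℝ → ℝ) : ℝ := sSup ((fun x => |f x|) '' Set.Icc (0:ℝ) 1)

/-- The `W^{1,∞}` norm of a `1`-periodic function. -/
noncomputable def W1infNorm (f : ℝ → ℝ) : ℝ := LinfNorm f + LinfNorm (deriv f)

/-- The artificial pressure `P_γ(r) = P(r) + (γ/2) r²`. -/
noncomputable def artificialPressure (P : ℝ → ℝ) (γ : ℝ) (r : ℝ) : ℝ := P r + γ / 2 * r ^ 2

/-- A pair `(P, γ)` is admissible (with exponent `β` and limit `a`). -/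
structure IsAdmissiblePair (P : ℝ → ℝ) (γ β a : ℝ) : Prop where
  gamma_pos : 0 < γ
  beta_ge : 2 ≤ β
  a_pos : 0 < a
  nonneg : ∀ r, 0 ≤ r → 0 ≤ P r
  smooth : ContDiffOn ℝ 1 P (Set.Ici 0)
  zero : P 0 = 0
  lim : Filter.Tendsto (fun r => deriv P r / r ^ (β - 1)) Filter.atTop (nhds a)
  mono : MonotoneOn (artificialPressure P γ) (Set.Ici 0)

/-- `W` is a pressure potential for `P`: `W : [0,∞) → [0,∞)`, twice continuously
differentiable on `(0,∞)`, with `W''(r)·r = P'(r)` for `r > 0`. -/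
structure IsPressurePotential (P W : ℝ → ℝ) : Prop where
  nonneg : ∀ r, 0 ≤ r → 0 ≤ W r
  smooth : ContDiffOn ℝ 2 W (Set.Ioi 0)
  relation : ∀ r : ℝ, 0 < r → deriv (deriv W) r * r = deriv P r

/-- A smooth `1`-periodic-in-space solution of the non-local Navier–Stokes–Korteweg
system on the time set `S`, with initial data `(ρ₀, u₀)`. -/
structure IsNSKSolution (μ κ γ : ℝ) (P : ℝ → ℝ) (S : Set ℝ)
    (ρ u c : ℝ → ℝ → ℝ) (ρ₀ u₀ : ℝ → ℝ) : Prop where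
  smooth_rho : ContDiffOn ℝ (⊤ : ℕ∞) (fun p : ℝ × ℝ => ρ p.1 p.2) (S ×ˢ (Set.univ : Set ℝ))
  smooth_u : ContDiffOn ℝ (⊤ : ℕ∞) (fun p : ℝ × ℝ => u p.1 p.2) (S ×ˢ (Set.univ : Set ℝ))
  smooth_c : ContDiffOn ℝ (⊤ : ℕ∞) (fun p : ℝ × ℝ => c p.1 p.2) (S ×ˢ (Set.univ : Set ℝ))
  periodic_rho : ∀ t x, ρ t (x + 1) = ρ t x
  periodic_u : ∀ t x, u t (x + 1) = u t x
  periodic_c : ∀ t x, c t (x + 1) = c t x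
  rho_pos : ∀ t x, 0 < ρ t x
  mass : ∀ t ∈ S, ∀ x : ℝ,
    deriv (fun s => ρ s x) t + deriv (fun y => ρ t y * u t y) x = 0
  momentum : ∀ t ∈ S, ∀ x : ℝ,
    deriv (fun s => ρ s x * u s x) t
      + deriv (fun y => ρ t y * u t y ^ 2) x
      + deriv (fun y => P (ρ t y)) x
      - μ * deriv (deriv (u t)) x
      - γ * ρ t x * deriv (fun y => c t y - ρ t y) x = 0
  elliptic : ∀ t ∈ S, ∀ x : ℝ,
    -κ * deriv (deriv (c t)) x + γ * (c t x - ρ t x) = 0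
  init_rho : ∀ x, ρ 0 x = ρ₀ x
  init_u : ∀ x, u 0 x = u₀ x

/-- A function whose second derivative is at least `c` beyond `R > 0` dominates
`(c / 4) r²` up to an additive constant. -/
theorem exists_quadratic_lower_bound {f : ℝ → ℝ} {c R : ℝ} (hc : 0 < c) (hR : 0 < R)
    (hf : ContDiffOn ℝ 2 f (Set.Ioi 0)) (h : ∀ r, R < r → c ≤ deriv (deriv f) r) :
    ∃ D ≥ 0, ∀ r, R + 2 < r → c / 4 * r ^ 2 ≤ f r + D := by
  have hd : ∀ r, 0 < r → HasDerivAt f (deriv f r) r := fun r hr =>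
    ((hf.differentiableOn (by norm_num)).differentiableAt (Ioi_mem_nhds hr)).hasDerivAt
  have hdf : ContDiffOn ℝ 1 (deriv f) (Set.Ioi 0) :=
    ((contDiffOn_succ_iff_deriv_of_isOpen (n := 1) isOpen_Ioi).1
      (by simpa [one_add_one_eq_two] using hf)).2.2
  have hdd : ∀ r, 0 < r → HasDerivAt (deriv f) (deriv (deriv f) r) r := fun r hr =>
    ((hdf.differentiableOn (by norm_num)).differentiableAt (Ioi_mem_nhds hr)).hasDerivAt
  have hg : ∀ r, 0 < r →
      HasDerivAt (fun x => f x - c / 2 * x ^ 2) (deriv f r - c * r) r := fun r hr => by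
    refine ((hd r hr).sub (((hasDerivAt_id r).pow 2).const_mul (c / 2))).congr_deriv ?_
    simp
    ring
  have hconv : ConvexOn ℝ (Set.Ioi R) (fun x => f x - c / 2 * x ^ 2) := by
    refine convexOn_of_hasDerivWithinAt2_nonneg (f' := fun r => deriv f r - c * r)
      (f'' := fun r => deriv (deriv f) r - c) (convex_Ioi R)
      (fun x hx => (hg x (hR.trans hx)).continuousAt.continuousWithinAt) ?_ ?_ ?_ <;>
      rw [interior_Ioi] <;> intro x hx
    · exact (hg x (hR.trans hx)).hasDerivWithinAt
    · refine (((hdd x (hR.trans hx)).sub ((hasDerivAt_id x).const_mul c)).congr_deriv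
        ?_).hasDerivWithinAt
      simp
    · exact sub_nonneg.2 (h x hx)
  set g : ℝ → ℝ := fun x => f x - c / 2 * x ^ 2 with hgdef
  set m := g (R + 2) - g (R + 1) with hm
  refine ⟨|g (R + 2)| + |m * (R + 2)| + m ^ 2 / c, by positivity, fun r hr => ?_⟩
  have hslope := hconv.slope_mono_adjacent (x := R + 1) (y := R + 2) (z := r)
    (by simp) (Set.mem_Ioi.2 (by linarith)) (by linarith) hr
  rw [show R + 2 - (R + 1) = 1 by ring, div_one, le_div_iff₀ (by linarith), ← hm] at hslope
  have hgr : g r = f r - c / 2 * r ^ 2 := rfl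
  have hsq : 0 ≤ c / 4 * r ^ 2 + m * r + m ^ 2 / c := by
    have : c / 4 * r ^ 2 + m * r + m ^ 2 / c = (c * r / 2 + m) ^ 2 / c := by
      field_simp
      ring
    rw [this]
    positivity
  linarith [neg_abs_le (g (R + 2)), le_abs_self (m * (R + 2))]

/-- If `P : [0,∞) → [0,∞)` is `C¹` with `P(0) = 0` and `P'(r)/r^{β−1} → a > 0` as
`r → ∞` for some `β ≥ 2`, and `W` is a pressure potential for `P`, then there is a
constant `C_ρ > 0` with `r² ≤ C_ρ + C_ρ·W(r)` for all `r ≥ 0`. -/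
theorem pressure_potential_quadratic_bound
    (P W : ℝ → ℝ) (β a : ℝ) (hβ : 2 ≤ β) (ha : 0 < a)
    (hPnonneg : ∀ r, 0 ≤ r → 0 ≤ P r) (hP0 : P 0 = 0)
    (hPsmooth : ContDiffOn ℝ 1 P (Set.Ici 0))
    (hlim : Filter.Tendsto (fun r => deriv P r / r ^ (β - 1)) Filter.atTop (nhds a))
    (hW : IsPressurePotential P W) :
    ∃ Cρ > 0, ∀ r : ℝ, 0 ≤ r → r ^ 2 ≤ Cρ + Cρ * W r := by
  obtain ⟨R₀, hR₀⟩ := Filter.eventually_atTop.1 (hlim.eventually_const_le (half_lt_self ha))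
  set R := max R₀ 1
  have hR : 1 ≤ R := le_max_right _ _
  have hW2 : ∀ r, R < r → a / 2 ≤ deriv (deriv W) r := fun r hr => by
    have hr1 : 1 ≤ r := hR.trans hr.le
    have hr0 : 0 < r := by linarith
    have hP' := hR₀ r ((le_max_left _ _).trans hr.le)
    rw [le_div_iff₀ (Real.rpow_pos_of_pos hr0 _), ← hW.relation r hr0] at hP'
    have hpow : r ≤ r ^ (β - 1) := Real.self_le_rpow_of_one_le hr1 (by linarith)
    exact le_of_mul_le_mul_right
      ((mul_le_mul_of_nonneg_left hpow (half_pos ha).le).trans hP') hr0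
  obtain ⟨D, hD, hbound⟩ :=
    exists_quadratic_lower_bound (half_pos ha) (by linarith) hW.smooth hW2
  refine ⟨8 / a * (1 + D) + (R + 2) ^ 2, by positivity, fun r hr => ?_⟩
  have hWr := hW.nonneg r hr
  rcases le_or_gt r (R + 2) with hle | hlt
  · have h1 : r ^ 2 ≤ (R + 2) ^ 2 := by gcongr
    have h2 : 0 ≤ 8 / a * (1 + D) := by positivity
    have h3 : 0 ≤ (8 / a * (1 + D) + (R + 2) ^ 2) * W r := by positivity
    linarith
  · have h1 : r ^ 2 ≤ 8 / a * (W r + D) := by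
      calc r ^ 2 = 8 / a * (a / 2 / 4 * r ^ 2) := by field_simp; ring
        _ ≤ 8 / a * (W r + D) := by gcongr; exact hbound r hlt
    have h2 : 0 ≤ 8 / a := by positivity
    have h3 : 0 ≤ 8 / a * (D * W r) := by positivity
    have h4 : 0 ≤ (R + 2) ^ 2 * W r := by positivity
    nlinarith [sq_nonneg (R + 2)]
end

section
/- Let μ, κ, γ, M₀, T > 0, let (P,γ) be an admissible pair with pressure potential W, and let (ρ,u,c) be a smooth periodic solution of the non-local Navier–Stokes–Korteweg system on [0,T) with initial data (ρ₀,u₀) satisfying M₀⁻¹ ≤ ρ₀(x) ≤ M₀ for all x. Then there exists a constant E₀ ≥ 0, depending only on M₀, ‖u₀‖_{L²(𝕋)}, max_{λ∈[M₀⁻¹,M₀]}|W(λ)|, γ and κ, such that for all t ∈ [0,T): ∫₀¹ [ (1/2)·ρ·u² + W(ρ) + (γ/2)·|ρ − c|² + (κ/2)·|∂_x c|² ](t,x) dx + ∫₀^t ∫₀¹ μ·|∂_x u(τ,x)|² dx dτ ≤ E₀. -/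
open MeasureTheory Filter Set

/-- The time derivative, relative to the time set `S`, of a function of time and space. -/
noncomputable def timeDeriv (S : Set ℝ) (f : ℝ → ℝ → ℝ) (t x : ℝ) : ℝ :=
  fderivWithin ℝ (fun p : ℝ × ℝ => f p.1 p.2) (S ×ˢ univ) (t, x) (1, 0)

/-- The space derivative, relative to the time set `S`, of a function of time and space. -/
noncomputable def spaceDeriv (S : Set ℝ) (f : ℝ → ℝ → ℝ) (t x : ℝ) : ℝ :=
  fderivWithin ℝ (fun p : ℝ × ℝ => f p.1 p.2) (S ×ˢ univ) (t, x) (0, 1)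

/-- Joint smoothness on `S × ℝ` of a function of time and space. -/
def SmoothOnSlab (S : Set ℝ) (f : ℝ → ℝ → ℝ) : Prop :=
  ContDiffOn ℝ (⊤ : ℕ∞) (fun p : ℝ × ℝ => f p.1 p.2) (S ×ˢ univ)

namespace SmoothOnSlab

variable {S : Set ℝ} {f : ℝ → ℝ → ℝ} {t : ℝ}

theorem continuousOn (hf : SmoothOnSlab S f) :
    ContinuousOn (fun p : ℝ × ℝ => f p.1 p.2) (S ×ˢ univ) :=
  ContDiffOn.continuousOn hf

theorem fderivWithin_apply (hf : SmoothOnSlab S f) (hS : UniqueDiffOn ℝ S) (v : ℝ × ℝ) :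
    ContDiffOn ℝ (⊤ : ℕ∞)
      (fun p => fderivWithin ℝ (fun p : ℝ × ℝ => f p.1 p.2) (S ×ˢ univ) p v) (S ×ˢ univ) :=
  (ContDiffOn.fderivWithin (m := ((⊤ : ℕ∞) : WithTop ℕ∞)) hf (hS.prod uniqueDiffOn_univ) (by norm_cast)).clm_apply
    contDiffOn_const

theorem timeDeriv (hf : SmoothOnSlab S f) (hS : UniqueDiffOn ℝ S) :
    SmoothOnSlab S (timeDeriv S f) :=
  hf.fderivWithin_apply hS (1, 0)

theorem spaceDeriv (hf : SmoothOnSlab S f) (hS : UniqueDiffOn ℝ S) :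
    SmoothOnSlab S (spaceDeriv S f) :=
  hf.fderivWithin_apply hS (0, 1)

theorem hasFDerivWithinAt (hf : SmoothOnSlab S f) (ht : t ∈ S) (x : ℝ) :
    HasFDerivWithinAt (fun p : ℝ × ℝ => f p.1 p.2)
      (fderivWithin ℝ (fun p : ℝ × ℝ => f p.1 p.2) (S ×ˢ univ) (t, x)) (S ×ˢ univ) (t, x) :=
  (ContDiffOn.differentiableOn hf (by simp) (t, x) ⟨ht, mem_univ x⟩).hasFDerivWithinAt

theorem hasDerivAt_space (hf : SmoothOnSlab S f) (ht : t ∈ S) (x : ℝ) :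
    HasDerivAt (f t) (_root_.spaceDeriv S f t x) x := by
  have h := (hf.hasFDerivWithinAt ht x).comp_hasDerivWithinAt (s := univ) x
    ((hasDerivWithinAt_const x univ t).prodMk (hasDerivWithinAt_id x univ))
    (fun y _ => ⟨ht, mem_univ y⟩)
  exact hasDerivWithinAt_univ.mp h

theorem hasDerivAt_time (hf : SmoothOnSlab S f) (ht : S ∈ nhds t) (x : ℝ) :
    HasDerivAt (fun s => f s x) (_root_.timeDeriv S f t x) t := by
  have h := (hf.hasFDerivWithinAt (mem_of_mem_nhds ht) x).comp_hasDerivWithinAt (s := S) t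
    ((hasDerivWithinAt_id t S).prodMk (hasDerivWithinAt_const t S x))
    (fun s hs => (⟨hs, mem_univ x⟩ : (s, x) ∈ S ×ˢ univ))
  exact h.hasDerivAt ht

theorem continuous_space (hf : SmoothOnSlab S f) (ht : t ∈ S) : Continuous (f t) :=
  continuous_iff_continuousAt.mpr fun x => (hf.hasDerivAt_space ht x).continuousAt

theorem timeDeriv_spaceDeriv (hf : SmoothOnSlab S f) (hS : UniqueDiffOn ℝ S)
    (ht : S ∈ nhds t) (x : ℝ) :
    _root_.timeDeriv S (_root_.spaceDeriv S f) t x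
      = _root_.spaceDeriv S (_root_.timeDeriv S f) t x := by
  have hU := hS.prod (uniqueDiffOn_univ (𝕜 := ℝ) (E := ℝ))
  have hmem : (t, x) ∈ S ×ˢ (univ : Set ℝ) := ⟨mem_of_mem_nhds ht, mem_univ x⟩
  have hsymm : IsSymmSndFDerivWithinAt ℝ (fun p : ℝ × ℝ => f p.1 p.2) (S ×ˢ univ) (t, x) := by
    refine ContDiffWithinAt.isSymmSndFDerivWithinAt (hf _ hmem)
      (by simpa using WithTop.coe_le_coe.2 (le_top : (2 : ℕ∞) ≤ ⊤)) hU
      (subset_closure ?_) hmem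
    exact mem_interior_iff_mem_nhds.mpr (prod_mem_nhds ht univ_mem)
  have hd : DifferentiableWithinAt ℝ
      (fderivWithin ℝ (fun p : ℝ × ℝ => f p.1 p.2) (S ×ˢ univ)) (S ×ˢ univ) (t, x) :=
    (ContDiffOn.fderivWithin (m := 1) hf hU (by norm_cast)).differentiableOn (by simp) _ hmem
  have key (v w : ℝ × ℝ) : fderivWithin ℝ (fun p =>
      fderivWithin ℝ (fun p : ℝ × ℝ => f p.1 p.2) (S ×ˢ univ) p v) (S ×ˢ univ) (t, x) w
      = fderivWithin ℝ (fderivWithin ℝ (fun p : ℝ × ℝ => f p.1 p.2) (S ×ˢ univ))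
        (S ×ˢ univ) (t, x) w v := by
    rw [fderivWithin_clm_apply (hU _ hmem) hd (differentiableWithinAt_const v)]
    simp
  exact (key _ _).trans ((hsymm.eq _ _).trans (key _ _).symm)

theorem periodic_timeDeriv (hf : SmoothOnSlab S f) (ht : S ∈ nhds t)
    (hper : ∀ s x, f s (x + 1) = f s x) (x : ℝ) :
    _root_.timeDeriv S f t (x + 1) = _root_.timeDeriv S f t x := by
  have h := hf.hasDerivAt_time ht (x + 1)
  simp only [hper] at h
  exact h.unique (hf.hasDerivAt_time ht x)

theorem periodic_spaceDeriv (hf : SmoothOnSlab S f) (ht : t ∈ S)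
    (hper : ∀ s x, f s (x + 1) = f s x) (x : ℝ) :
    _root_.spaceDeriv S f t (x + 1) = _root_.spaceDeriv S f t x := by
  have h := (hf.hasDerivAt_space ht (x + 1)).comp_add_const x 1
  simp only [hper] at h
  exact h.unique (hf.hasDerivAt_space ht x)

end SmoothOnSlab

/-- The energy density of the non-local Navier–Stokes–Korteweg system. -/
noncomputable def energyDensity (κ γ : ℝ) (S : Set ℝ) (W : ℝ → ℝ) (ρ u c : ℝ → ℝ → ℝ)
    (t x : ℝ) : ℝ :=
  1 / 2 * ρ t x * u t x ^ 2 + W (ρ t x) + γ / 2 * (ρ t x - c t x) ^ 2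
    + κ / 2 * spaceDeriv S c t x ^ 2

/-- The time derivative of the energy density. -/
noncomputable def energyRate (κ γ : ℝ) (S : Set ℝ) (W : ℝ → ℝ) (ρ u c : ℝ → ℝ → ℝ)
    (t x : ℝ) : ℝ :=
  1 / 2 * timeDeriv S ρ t x * u t x ^ 2 + ρ t x * u t x * timeDeriv S u t x
    + deriv W (ρ t x) * timeDeriv S ρ t x
    + γ * (ρ t x - c t x) * (timeDeriv S ρ t x - timeDeriv S c t x)
    + κ * spaceDeriv S c t x * timeDeriv S (spaceDeriv S c) t x

/-- The spatial flux in the local energy balance. -/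
noncomputable def energyFlux (μ κ γ : ℝ) (S : Set ℝ) (W : ℝ → ℝ) (ρ u c : ℝ → ℝ → ℝ)
    (t x : ℝ) : ℝ :=
  -(1 / 2) * (ρ t x * u t x ^ 3) - deriv W (ρ t x) * (ρ t x * u t x)
    + μ * (u t x * spaceDeriv S u t x) + γ * ((c t x - ρ t x) * (ρ t x * u t x))
    + κ * (spaceDeriv S c t x * timeDeriv S c t x)

namespace IsPressurePotential

variable {P W : ℝ → ℝ} {r : ℝ}

theorem hasDerivAt (hW : IsPressurePotential P W) (hr : 0 < r) :
    HasDerivAt W (deriv W r) r :=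
  ((hW.smooth.contDiffAt (Ioi_mem_nhds hr)).differentiableAt (by simp)).hasDerivAt

theorem hasDerivAt_deriv (hW : IsPressurePotential P W) (hr : 0 < r) :
    HasDerivAt (deriv W) (deriv (deriv W) r) r :=
  (((hW.smooth.deriv_of_isOpen (m := 1) isOpen_Ioi (by norm_num)).contDiffAt
    (Ioi_mem_nhds hr)).differentiableAt (by simp)).hasDerivAt

end IsPressurePotential

namespace IsNSKSolution

variable {μ κ γ : ℝ} {P W : ℝ → ℝ} {S : Set ℝ} {ρ u c : ℝ → ℝ → ℝ} {ρ₀ u₀ : ℝ → ℝ} {t : ℝ}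

theorem smoothOnSlab_rho (h : IsNSKSolution μ κ γ P S ρ u c ρ₀ u₀) : SmoothOnSlab S ρ :=
  h.smooth_rho

theorem smoothOnSlab_u (h : IsNSKSolution μ κ γ P S ρ u c ρ₀ u₀) : SmoothOnSlab S u :=
  h.smooth_u

theorem smoothOnSlab_c (h : IsNSKSolution μ κ γ P S ρ u c ρ₀ u₀) : SmoothOnSlab S c :=
  h.smooth_c

theorem deriv_c (h : IsNSKSolution μ κ γ P S ρ u c ρ₀ u₀) (ht : t ∈ S) :
    deriv (c t) = spaceDeriv S c t :=
  funext fun x => (h.smoothOnSlab_c.hasDerivAt_space ht x).deriv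

theorem deriv_u (h : IsNSKSolution μ κ γ P S ρ u c ρ₀ u₀) (ht : t ∈ S) :
    deriv (u t) = spaceDeriv S u t :=
  funext fun x => (h.smoothOnSlab_u.hasDerivAt_space ht x).deriv

theorem elliptic_spaceDeriv (h : IsNSKSolution μ κ γ P S ρ u c ρ₀ u₀) (hS : UniqueDiffOn ℝ S)
    (ht : t ∈ S) (x : ℝ) :
    -κ * spaceDeriv S (spaceDeriv S c) t x + γ * (c t x - ρ t x) = 0 := by
  rw [← ((h.smoothOnSlab_c.spaceDeriv hS).hasDerivAt_space ht x).deriv, ← h.deriv_c ht]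
  exact h.elliptic t ht x

theorem hasDerivAt_energyDensity (h : IsNSKSolution μ κ γ P S ρ u c ρ₀ u₀)
    (hW : IsPressurePotential P W) (hS : UniqueDiffOn ℝ S) (ht : S ∈ nhds t) (x : ℝ) :
    HasDerivAt (fun s => energyDensity κ γ S W ρ u c s x) (energyRate κ γ S W ρ u c t x) t := by
  have hρ := h.smoothOnSlab_rho.hasDerivAt_time ht x
  have hu := h.smoothOnSlab_u.hasDerivAt_time ht x
  have hc := h.smoothOnSlab_c.hasDerivAt_time ht x
  have hcx := (h.smoothOnSlab_c.spaceDeriv hS).hasDerivAt_time ht x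
  have hWρ := (hW.hasDerivAt (h.rho_pos t x)).comp t hρ
  convert! ((((hρ.const_mul (1 / 2)).mul (hu.pow 2)).add hWρ).add
    (((hρ.sub hc).pow 2).const_mul (γ / 2))).add ((hcx.pow 2).const_mul (κ / 2)) using 1
  simp [energyRate]
  ring

theorem hasDerivAt_energyFlux (h : IsNSKSolution μ κ γ P S ρ u c ρ₀ u₀)
    (hP : DifferentiableOn ℝ P (Ioi 0)) (hW : IsPressurePotential P W) (hS : UniqueDiffOn ℝ S)
    (ht : S ∈ nhds t) (x : ℝ) :
    HasDerivAt (energyFlux μ κ γ S W ρ u c t)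
      (energyRate κ γ S W ρ u c t x + μ * spaceDeriv S u t x ^ 2) x := by
  have htS := mem_of_mem_nhds ht
  have hpos := h.rho_pos t x
  have hρt := h.smoothOnSlab_rho.hasDerivAt_time ht x
  have hut := h.smoothOnSlab_u.hasDerivAt_time ht x
  have hρ := h.smoothOnSlab_rho.hasDerivAt_space htS x
  have hu := h.smoothOnSlab_u.hasDerivAt_space htS x
  have hc := h.smoothOnSlab_c.hasDerivAt_space htS x
  have hux := (h.smoothOnSlab_u.spaceDeriv hS).hasDerivAt_space htS x
  have hcx := (h.smoothOnSlab_c.spaceDeriv hS).hasDerivAt_space htS x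
  have hct := (h.smoothOnSlab_c.timeDeriv hS).hasDerivAt_space htS x
  rw [← h.smoothOnSlab_c.timeDeriv_spaceDeriv hS ht x] at hct
  have hWρ := (hW.hasDerivAt_deriv hpos).comp x hρ
  have hPρ := (hP.hasDerivAt (Ioi_mem_nhds hpos)).comp x hρ
  have mass := h.mass t htS x
  have momentum := h.momentum t htS x
  have elliptic := h.elliptic_spaceDeriv hS htS x
  rw [hρt.deriv, (hρ.fun_mul hu).deriv] at mass
  have hP' : deriv (fun y => P (ρ t y)) x = _ := hPρ.deriv
  rw [(hρt.fun_mul hut).deriv, (hρ.fun_mul (hu.fun_pow 2)).deriv, hP', h.deriv_u htS, hux.deriv,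
    (hc.fun_sub hρ).deriv, ← hW.relation _ hpos] at momentum
  convert! (((((hρ.mul (hu.pow 3)).const_mul (-(1 / 2))).sub (hWρ.mul (hρ.mul hu))).add
    ((hu.mul hux).const_mul μ)).add (((hc.sub hρ).mul (hρ.mul hu)).const_mul γ)).add
    ((hcx.mul hct).const_mul κ) using 1
  simp [energyRate] at momentum ⊢
  linear_combination u t x * momentum
    + (-(1 / 2) * u t x ^ 2 + deriv W (ρ t x) + γ * (ρ t x - c t x)) * mass
    + timeDeriv S c t x * elliptic

theorem continuousOn_energyDensity (h : IsNSKSolution μ κ γ P S ρ u c ρ₀ u₀)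
    (hW : IsPressurePotential P W) (hS : UniqueDiffOn ℝ S) :
    ContinuousOn (fun p : ℝ × ℝ => energyDensity κ γ S W ρ u c p.1 p.2) (S ×ˢ univ) := by
  have hρ := h.smoothOnSlab_rho.continuousOn
  have hu := h.smoothOnSlab_u.continuousOn
  have hc := h.smoothOnSlab_c.continuousOn
  have hcx := (h.smoothOnSlab_c.spaceDeriv hS).continuousOn
  have hWρ : ContinuousOn (fun p : ℝ × ℝ => W (ρ p.1 p.2)) (S ×ˢ univ) :=
    hW.smooth.continuousOn.comp hρ fun p _ => h.rho_pos p.1 p.2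
  exact ((((hρ.const_mul (1 / 2)).mul (hu.pow 2)).add hWρ).add
    (((hρ.sub hc).pow 2).const_mul (γ / 2))).add ((hcx.pow 2).const_mul (κ / 2))

theorem continuousOn_energyRate (h : IsNSKSolution μ κ γ P S ρ u c ρ₀ u₀)
    (hW : IsPressurePotential P W) (hS : UniqueDiffOn ℝ S) :
    ContinuousOn (fun p : ℝ × ℝ => energyRate κ γ S W ρ u c p.1 p.2) (S ×ˢ univ) := by
  have hρ := h.smoothOnSlab_rho.continuousOn
  have hu := h.smoothOnSlab_u.continuousOn
  have hc := h.smoothOnSlab_c.continuousOn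
  have hcx := (h.smoothOnSlab_c.spaceDeriv hS).continuousOn
  have hρt := (h.smoothOnSlab_rho.timeDeriv hS).continuousOn
  have hut := (h.smoothOnSlab_u.timeDeriv hS).continuousOn
  have hct := (h.smoothOnSlab_c.timeDeriv hS).continuousOn
  have hcxt := ((h.smoothOnSlab_c.spaceDeriv hS).timeDeriv hS).continuousOn
  have hWρ : ContinuousOn (fun p : ℝ × ℝ => deriv W (ρ p.1 p.2)) (S ×ˢ univ) :=
    (hW.smooth.continuousOn_deriv_of_isOpen isOpen_Ioi (by norm_num)).comp hρ
      fun p _ => h.rho_pos p.1 p.2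
  unfold energyRate
  fun_prop

theorem continuous_energyDensity (h : IsNSKSolution μ κ γ P S ρ u c ρ₀ u₀)
    (hW : IsPressurePotential P W) (hS : UniqueDiffOn ℝ S) (ht : t ∈ S) :
    Continuous (energyDensity κ γ S W ρ u c t) :=
  (h.continuousOn_energyDensity hW hS).comp_continuous (f := fun x => (t, x)) (by fun_prop)
    fun x => ⟨ht, mem_univ x⟩

theorem continuous_energyRate (h : IsNSKSolution μ κ γ P S ρ u c ρ₀ u₀)
    (hW : IsPressurePotential P W) (hS : UniqueDiffOn ℝ S) (ht : t ∈ S) :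
    Continuous (energyRate κ γ S W ρ u c t) :=
  (h.continuousOn_energyRate hW hS).comp_continuous (f := fun x => (t, x)) (by fun_prop)
    fun x => ⟨ht, mem_univ x⟩

theorem integral_energyRate (h : IsNSKSolution μ κ γ P S ρ u c ρ₀ u₀)
    (hP : DifferentiableOn ℝ P (Ioi 0)) (hW : IsPressurePotential P W) (hS : UniqueDiffOn ℝ S)
    (ht : S ∈ nhds t) :
    ∫ x in (0 : ℝ)..1, energyRate κ γ S W ρ u c t x
      = -∫ x in (0 : ℝ)..1, μ * deriv (u t) x ^ 2 := by
  have htS := mem_of_mem_nhds ht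
  have hrate := h.continuous_energyRate (κ := κ) (γ := γ) hW hS htS
  have hdiss : Continuous fun x => μ * spaceDeriv S u t x ^ 2 :=
    (((h.smoothOnSlab_u.spaceDeriv hS).continuous_space htS).pow 2).const_mul μ
  have hint := intervalIntegral.integral_eq_sub_of_hasDerivAt (a := 0) (b := 1)
    (fun x _ => h.hasDerivAt_energyFlux hP hW hS ht x)
    ((hrate.add hdiss).intervalIntegrable 0 1)
  rw [intervalIntegral.integral_add (hrate.intervalIntegrable 0 1)
    (hdiss.intervalIntegrable 0 1)] at hint
  have hflux : energyFlux μ κ γ S W ρ u c t 1 = energyFlux μ κ γ S W ρ u c t 0 := by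
    have hρ := h.periodic_rho t 0
    have hu := h.periodic_u t 0
    have hc := h.periodic_c t 0
    have hux := h.smoothOnSlab_u.periodic_spaceDeriv htS h.periodic_u 0
    have hcx := h.smoothOnSlab_c.periodic_spaceDeriv htS h.periodic_c 0
    have hct := h.smoothOnSlab_c.periodic_timeDeriv ht h.periodic_c 0
    rw [zero_add] at hρ hu hc hux hcx hct
    simp only [energyFlux, hρ, hu, hc, hux, hcx, hct]
  rw [hflux, sub_self] at hint
  rw [h.deriv_u htS]
  linarith

theorem energy_equality {T : ℝ} (h : IsNSKSolution μ κ γ P (Ico 0 T) ρ u c ρ₀ u₀)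
    (hP : DifferentiableOn ℝ P (Ioi 0)) (hW : IsPressurePotential P W) (ht : t ∈ Ico 0 T) :
    (∫ x in (0 : ℝ)..1, energyDensity κ γ (Ico 0 T) W ρ u c t x)
      + (∫ τ in (0 : ℝ)..t, ∫ x in (0 : ℝ)..1, μ * deriv (u τ) x ^ 2)
      = ∫ x in (0 : ℝ)..1, energyDensity κ γ (Ico 0 T) W ρ u c 0 x := by
  have hS : UniqueDiffOn ℝ (Ico 0 T) := uniqueDiffOn_Ico 0 T
  have h0 : (0 : ℝ) ∈ Ico 0 T := ⟨le_rfl, ht.1.trans_lt ht.2⟩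
  have hsub : Icc 0 t ⊆ Ico 0 T := Icc_subset_Ico_right ht.2
  have hslice (x : ℝ) : MapsTo (fun s => (s, x)) (Icc 0 t) (Ico 0 T ×ˢ univ) :=
    fun s hs => ⟨hsub hs, mem_univ x⟩
  have hrate := h.continuousOn_energyRate (κ := κ) (γ := γ) hW hS
  have htime (x : ℝ) : ∫ τ in (0 : ℝ)..t, energyRate κ γ (Ico 0 T) W ρ u c τ x
      = energyDensity κ γ (Ico 0 T) W ρ u c t x - energyDensity κ γ (Ico 0 T) W ρ u c 0 x := by
    refine intervalIntegral.integral_eq_sub_of_hasDerivAt_of_le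
      (f := fun s => energyDensity κ γ (Ico 0 T) W ρ u c s x) ht.1
      ((h.continuousOn_energyDensity hW hS).comp (f := fun s => (s, x)) (by fun_prop) (hslice x))
      (fun s hs => h.hasDerivAt_energyDensity hW hS
        (Ico_mem_nhds hs.1 (hs.2.trans ht.2)) x) ?_
    refine ContinuousOn.intervalIntegrable ?_
    rw [uIcc_of_le ht.1]
    exact hrate.comp (f := fun s => (s, x)) (by fun_prop) (hslice x)
  have hswap : ∫ τ in (0 : ℝ)..t, ∫ x in (0 : ℝ)..1, energyRate κ γ (Ico 0 T) W ρ u c τ x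
      = ∫ x in (0 : ℝ)..1, ∫ τ in (0 : ℝ)..t, energyRate κ γ (Ico 0 T) W ρ u c τ x := by
    refine intervalIntegral_intervalIntegral_swap ?_
    rw [uIoc_of_le ht.1, uIoc_of_le zero_le_one]
    refine IntegrableOn.mono_set (t := Icc 0 t ×ˢ Icc 0 1) ?_
      (prod_mono Ioc_subset_Icc_self Ioc_subset_Icc_self)
    exact (hrate.mono (prod_mono hsub (subset_univ _))).integrableOn_compact
      (isCompact_Icc.prod isCompact_Icc)
  have hspace : ∫ τ in (0 : ℝ)..t, ∫ x in (0 : ℝ)..1, energyRate κ γ (Ico 0 T) W ρ u c τ x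
      = -∫ τ in (0 : ℝ)..t, ∫ x in (0 : ℝ)..1, μ * deriv (u τ) x ^ 2 := by
    rw [← intervalIntegral.integral_neg]
    exact intervalIntegral.integral_congr_Ioo_of_le ht.1 fun τ hτ =>
      h.integral_energyRate hP hW hS (Ico_mem_nhds hτ.1 (hτ.2.trans ht.2))
  rw [hspace] at hswap
  simp only [htime] at hswap
  rw [intervalIntegral.integral_sub
    ((h.continuous_energyDensity hW hS ht).intervalIntegrable 0 1)
    ((h.continuous_energyDensity hW hS h0).intervalIntegrable 0 1)] at hswap
  linarith

/-- The screening field minimises the non-local capillary energy, so the latter is bounded by its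
value at `c = 0`. -/
theorem integral_capillary_le (h : IsNSKSolution μ κ γ P S ρ u c ρ₀ u₀) (hS : UniqueDiffOn ℝ S)
    (hκ : 0 ≤ κ) (hγ : 0 ≤ γ) (ht : t ∈ S) :
    ∫ x in (0 : ℝ)..1, (γ / 2 * (ρ t x - c t x) ^ 2 + κ / 2 * spaceDeriv S c t x ^ 2)
      ≤ ∫ x in (0 : ℝ)..1, γ / 2 * ρ t x ^ 2 := by
  have hρ := h.smoothOnSlab_rho.continuous_space ht
  have hc := h.smoothOnSlab_c.continuous_space ht
  have hcx := (h.smoothOnSlab_c.spaceDeriv hS).continuous_space ht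
  have hcxx := ((h.smoothOnSlab_c.spaceDeriv hS).spaceDeriv hS).continuous_space ht
  have hparts : ∫ x in (0 : ℝ)..1, κ * (spaceDeriv S (spaceDeriv S c) t x * c t x
      + spaceDeriv S c t x * spaceDeriv S c t x) = 0 := by
    rw [intervalIntegral.integral_eq_sub_of_hasDerivAt
      (fun x _ => (((h.smoothOnSlab_c.spaceDeriv hS).hasDerivAt_space ht x).mul
        (h.smoothOnSlab_c.hasDerivAt_space ht x)).const_mul κ)
      (Continuous.intervalIntegrable (by fun_prop) 0 1)]
    have hper := h.periodic_c t 0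
    have hperx := h.smoothOnSlab_c.periodic_spaceDeriv ht h.periodic_c 0
    rw [zero_add] at hper hperx
    simp [hper, hperx]
  refine ((sub_zero _).symm.trans (congrArg (_ - ·) hparts.symm)).trans_le ?_
  rw [← intervalIntegral.integral_sub
    (Continuous.intervalIntegrable (by fun_prop) 0 1)
    (Continuous.intervalIntegrable (by fun_prop) 0 1)]
  refine intervalIntegral.integral_mono_on zero_le_one
    (Continuous.intervalIntegrable (by fun_prop) 0 1)
    (Continuous.intervalIntegrable (by fun_prop) 0 1) fun x _ => ?_
  have hell := h.elliptic_spaceDeriv hS ht x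
  linear_combination c t x * hell + 1 / 2 * mul_nonneg hγ (sq_nonneg (c t x))
    + 1 / 2 * mul_nonneg hκ (sq_nonneg (spaceDeriv S c t x))

end IsNSKSolution

theorem IsPressurePotential.le_sSup {P W : ℝ → ℝ} (hW : IsPressurePotential P W) {a b r : ℝ}
    (ha : 0 < a) (hr : r ∈ Icc a b) : W r ≤ sSup ((fun l => |W l|) '' Icc a b) := by
  have hcont : ContinuousOn (fun l => |W l|) (Icc a b) :=
    (hW.smooth.continuousOn.mono fun l hl => ha.trans_le hl.1).abs
  exact (le_abs_self _).trans
    (le_csSup (isCompact_Icc.image_of_continuousOn hcont).bddAbove (mem_image_of_mem _ hr))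

/-- The initial energy is controlled by the bounds on the initial data. -/
theorem IsNSKSolution.integral_energyDensity_zero_le {μ κ γ M : ℝ} {P W : ℝ → ℝ} {S : Set ℝ}
    {ρ u c : ℝ → ℝ → ℝ} {ρ₀ u₀ : ℝ → ℝ} (h : IsNSKSolution μ κ γ P S ρ u c ρ₀ u₀)
    (hW : IsPressurePotential P W) (hS : UniqueDiffOn ℝ S) (h0 : 0 ∈ S)
    (hκ : 0 ≤ κ) (hγ : 0 ≤ γ) (hM : 0 < M) (hρ₀ : ∀ x, M⁻¹ ≤ ρ₀ x ∧ ρ₀ x ≤ M) :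
    ∫ x in (0 : ℝ)..1, energyDensity κ γ S W ρ u c 0 x
      ≤ M / 2 * L2norm u₀ ^ 2 + sSup ((fun l => |W l|) '' Icc M⁻¹ M) + γ / 2 * M ^ 2 := by
  have hρ := h.smoothOnSlab_rho.continuous_space h0
  have hu := h.smoothOnSlab_u.continuous_space h0
  have hc := h.smoothOnSlab_c.continuous_space h0
  have hcx := (h.smoothOnSlab_c.spaceDeriv hS).continuous_space h0
  have hWρ : Continuous fun x => W (ρ 0 x) :=
    hW.smooth.continuousOn.comp_continuous hρ fun x => h.rho_pos 0 x
  have hρM (x : ℝ) : ρ 0 x ∈ Icc M⁻¹ M := h.init_rho x ▸ hρ₀ x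
  set K := sSup ((fun l => |W l|) '' Icc M⁻¹ M)
  have hL2 : L2norm u₀ ^ 2 = ∫ x in (0 : ℝ)..1, u 0 x ^ 2 := by
    rw [L2norm, Real.sq_sqrt (intervalIntegral.integral_nonneg zero_le_one
      fun x _ => sq_nonneg (u₀ x))]
    simp only [h.init_u]
  have hbulk_cont : Continuous fun x => 1 / 2 * ρ 0 x * u 0 x ^ 2 + W (ρ 0 x) :=
    ((hρ.const_mul (1 / 2)).mul (hu.pow 2)).add hWρ
  have hsplit : ∫ x in (0 : ℝ)..1, energyDensity κ γ S W ρ u c 0 x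
      = (∫ x in (0 : ℝ)..1, (1 / 2 * ρ 0 x * u 0 x ^ 2 + W (ρ 0 x)))
        + ∫ x in (0 : ℝ)..1, (γ / 2 * (ρ 0 x - c 0 x) ^ 2
          + κ / 2 * spaceDeriv S c 0 x ^ 2) := by
    rw [← intervalIntegral.integral_add (hbulk_cont.intervalIntegrable 0 1)
      (Continuous.intervalIntegrable (by fun_prop) 0 1)]
    simp only [energyDensity, add_assoc]
  have hbulk : (∫ x in (0 : ℝ)..1, (1 / 2 * ρ 0 x * u 0 x ^ 2 + W (ρ 0 x)))
      ≤ ∫ x in (0 : ℝ)..1, (M / 2 * u 0 x ^ 2 + K) := by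
    refine intervalIntegral.integral_mono_on zero_le_one (hbulk_cont.intervalIntegrable 0 1)
      (Continuous.intervalIntegrable (by fun_prop) 0 1) fun x _ => add_le_add ?_
        (hW.le_sSup (inv_pos.mpr hM) (hρM x))
    exact mul_le_mul_of_nonneg_right (by linarith [(hρM x).2]) (sq_nonneg _)
  have hcap : ∫ x in (0 : ℝ)..1, γ / 2 * ρ 0 x ^ 2 ≤ ∫ _x in (0 : ℝ)..1, γ / 2 * M ^ 2 := by
    refine intervalIntegral.integral_mono_on zero_le_one
      (Continuous.intervalIntegrable (by fun_prop) 0 1)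
      (Continuous.intervalIntegrable (by fun_prop) 0 1) fun x _ => ?_
    have := h.rho_pos 0 x
    have := (hρM x).2
    gcongr
  rw [intervalIntegral.integral_add (f := fun x => M / 2 * u 0 x ^ 2) (g := fun _ => K)
    (Continuous.intervalIntegrable (by fun_prop) 0 1)
    (Continuous.intervalIntegrable (by fun_prop) 0 1), intervalIntegral.integral_const_mul,
    ← hL2] at hbulk
  simp only [intervalIntegral.integral_const, sub_zero, one_smul] at hbulk hcap
  linarith [h.integral_capillary_le hS hκ hγ h0]

/-- Energy dissipation: there is a constant `E₀ ≥ 0`, depending only on `M₀`,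
`‖u₀‖_{L²(𝕋)}`, `max_{λ ∈ [M₀⁻¹, M₀]} |W(λ)|`, `γ` and `κ`, bounding the total energy
plus dissipation of any smooth periodic solution of the non-local NSK system. -/
theorem energy_dissipation :
    ∃ E : ℝ → ℝ → ℝ → ℝ → ℝ → ℝ,
      ∀ (μ κ γ M₀ T β a : ℝ) (P W : ℝ → ℝ) (ρ u c : ℝ → ℝ → ℝ) (ρ₀ u₀ : ℝ → ℝ),
        0 < μ → 0 < κ → 0 < γ → 0 < M₀ → 0 < T →
        IsAdmissiblePair P γ β a → IsPressurePotential P W →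
        IsNSKSolution μ κ γ P (Set.Ico 0 T) ρ u c ρ₀ u₀ →
        (∀ x : ℝ, M₀⁻¹ ≤ ρ₀ x ∧ ρ₀ x ≤ M₀) →
        0 ≤ E M₀ (L2norm u₀) (sSup ((fun l => |W l|) '' Set.Icc M₀⁻¹ M₀)) γ κ ∧
        ∀ t ∈ Set.Ico 0 T,
          (∫ x in (0:ℝ)..1,
              (1 / 2 * ρ t x * u t x ^ 2 + W (ρ t x)
                + γ / 2 * (ρ t x - c t x) ^ 2 + κ / 2 * deriv (c t) x ^ 2))
            + (∫ τ in (0:ℝ)..t, ∫ x in (0:ℝ)..1, μ * deriv (u τ) x ^ 2)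
          ≤ E M₀ (L2norm u₀) (sSup ((fun l => |W l|) '' Set.Icc M₀⁻¹ M₀)) γ κ := by
  refine ⟨fun M L K γ _ => M / 2 * L ^ 2 + K + γ / 2 * M ^ 2, ?_⟩
  intro μ κ γ M₀ T β a P W ρ u c ρ₀ u₀ _ hκ hγ hM hT hadm hW h hρ₀
  constructor
  · have hK : 0 ≤ sSup ((fun l => |W l|) '' Set.Icc M₀⁻¹ M₀) :=
      Real.sSup_nonneg (by rintro _ ⟨l, _, rfl⟩; exact abs_nonneg _)
    positivity
  · intro t ht
    have hP : DifferentiableOn ℝ P (Ioi 0) :=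
      (hadm.smooth.differentiableOn (by simp)).mono Ioi_subset_Ici_self
    rw [h.deriv_c ht]
    exact (h.energy_equality hP hW ht).trans_le
      (h.integral_energyDensity_zero_le hW (uniqueDiffOn_Ico 0 T) ⟨le_rfl, hT⟩ hκ.le hγ.le hM hρ₀)
end

section
/- Let μ, κ, γ, M₀, T > 0, let (P,γ) be an admissible pair with pressure potential W, and let (ρ,u,c) be a smooth periodic solution of the non-local Navier–Stokes–Korteweg system on [0,T) with initial data (ρ₀,u₀) satisfying M₀⁻¹ ≤ ρ₀(x) ≤ M₀ for all x. Then there exists a constant E₁ ≥ 0, depending only on M₀, ‖u₀‖_{L²(𝕋)}, μ, γ, κ and W, such that for all t ∈ [0,T): ‖ρ(t,·)‖_{L²(𝕋)} + ‖c(t,·)‖_{W^{1,∞}(𝕋)} + ‖c(t,·)‖_{H²(𝕋)} ≤ E₁. -/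
open MeasureTheory Filter Set

/-- The spatial slice of a `C¹` function on `S × ℝ` has the expected directional derivative. -/
lemma hasDerivAt_slice_space {n : WithTop ℕ∞} {S : Set ℝ} {F : ℝ → ℝ → ℝ} (hn : n ≠ 0)
    (hF : ContDiffOn ℝ n (fun p : ℝ × ℝ => F p.1 p.2) (S ×ˢ univ)) {t : ℝ} (ht : t ∈ S) (x : ℝ) :
    HasDerivAt (F t)
      (fderivWithin ℝ (fun p : ℝ × ℝ => F p.1 p.2) (S ×ˢ univ) (t, x) (0, 1)) x := by
  have hd := ((hF.differentiableOn hn) (t, x) ⟨ht, mem_univ _⟩).hasFDerivWithinAt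
  have hg : HasDerivWithinAt (fun y : ℝ => (t, y)) ((0 : ℝ), (1 : ℝ)) univ x :=
    ((hasDerivAt_const x t).prodMk (hasDerivAt_id x)).hasDerivWithinAt
  have := hd.comp_hasDerivWithinAt x hg (fun y _ => ⟨ht, mem_univ _⟩)
  rw [hasDerivWithinAt_univ] at this
  exact this

lemma two_le_coe_top : (2 : WithTop ℕ∞) ≤ ((⊤ : ℕ∞) : WithTop ℕ∞) :=
  WithTop.coe_le_coe.2 (le_top : (2 : ℕ∞) ≤ ⊤)

lemma contDiffOn_deriv_space {S : Set ℝ} (hS : UniqueDiffOn ℝ S) {F : ℝ → ℝ → ℝ}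
    (hF : ContDiffOn ℝ (⊤ : ℕ∞) (fun p : ℝ × ℝ => F p.1 p.2) (S ×ˢ univ)) :
    ContDiffOn ℝ (⊤ : ℕ∞) (fun p : ℝ × ℝ => deriv (F p.1) p.2) (S ×ˢ univ) := by
  have h := (hF.fderivWithin (m := (⊤ : ℕ∞)) (hS.prod uniqueDiffOn_univ) (by simp)).clm_apply
    (contDiffOn_const (c := ((0 : ℝ), (1 : ℝ))))
  exact h.congr fun p hp => (hasDerivAt_slice_space (by simp) hF hp.1 p.2).deriv

lemma contDiff_slice_space {n : WithTop ℕ∞} {S : Set ℝ} {F : ℝ → ℝ → ℝ}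
    (hF : ContDiffOn ℝ n (fun p : ℝ × ℝ => F p.1 p.2) (S ×ˢ univ)) {t : ℝ} (ht : t ∈ S) :
    ContDiff ℝ n (F t) := by
  have := hF.comp (s := univ) (contDiff_const.prodMk contDiff_id).contDiffOn
    (fun y _ => (⟨ht, mem_univ _⟩ : ((t, y) : ℝ × ℝ) ∈ S ×ˢ (univ : Set ℝ)))
  exact contDiffOn_univ.1 this

lemma hasDerivAt_slice_time {n : WithTop ℕ∞} {U : Set ℝ} (hU : IsOpen U) {F : ℝ → ℝ → ℝ}
    (hn : n ≠ 0) (hF : ContDiffOn ℝ n (fun p : ℝ × ℝ => F p.1 p.2) (U ×ˢ univ))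
    {t : ℝ} (ht : t ∈ U) (x : ℝ) :
    HasDerivAt (fun s => F s x) (fderiv ℝ (fun p : ℝ × ℝ => F p.1 p.2) (t, x) (1, 0)) t := by
  have hd := ((hF.differentiableOn hn).differentiableAt
    ((hU.prod isOpen_univ).mem_nhds (⟨ht, mem_univ _⟩ : ((t, x) : ℝ × ℝ) ∈ U ×ˢ univ))).hasFDerivAt
  have hg : HasDerivAt (fun s : ℝ => (s, x)) ((1 : ℝ), (0 : ℝ)) t :=
    (hasDerivAt_id t).prodMk (hasDerivAt_const t x)
  exact hd.comp_hasDerivAt t hg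

lemma hasDerivAt_slice_space_of_isOpen {n : WithTop ℕ∞} {U : Set ℝ} (hU : IsOpen U)
    {F : ℝ → ℝ → ℝ} (hn : n ≠ 0)
    (hF : ContDiffOn ℝ n (fun p : ℝ × ℝ => F p.1 p.2) (U ×ˢ univ)) {t : ℝ} (ht : t ∈ U) (x : ℝ) :
    HasDerivAt (F t) (fderiv ℝ (fun p : ℝ × ℝ => F p.1 p.2) (t, x) (0, 1)) x := by
  rw [← fderivWithin_of_isOpen (hU.prod isOpen_univ) (⟨ht, mem_univ _⟩ : (t, x) ∈ U ×ˢ univ)]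
  exact hasDerivAt_slice_space hn hF ht x

lemma contDiffOn_deriv_time {U : Set ℝ} (hU : IsOpen U) {F : ℝ → ℝ → ℝ}
    (hF : ContDiffOn ℝ (⊤ : ℕ∞) (fun p : ℝ × ℝ => F p.1 p.2) (U ×ˢ univ)) :
    ContDiffOn ℝ (⊤ : ℕ∞) (fun p : ℝ × ℝ => deriv (fun s => F s p.2) p.1) (U ×ˢ univ) := by
  have h := (hF.fderiv_of_isOpen (m := (⊤ : ℕ∞)) (hU.prod isOpen_univ) (by simp)).clm_apply
    (contDiffOn_const (c := ((1 : ℝ), (0 : ℝ))))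
  exact h.congr fun p hp => (hasDerivAt_slice_time hU (by simp) hF hp.1 p.2).deriv

/-- Time and space derivatives of a smooth function commute. -/
lemma deriv_time_deriv_space {U : Set ℝ} (hU : IsOpen U) {F : ℝ → ℝ → ℝ}
    (hF : ContDiffOn ℝ (⊤ : ℕ∞) (fun p : ℝ × ℝ => F p.1 p.2) (U ×ˢ univ)) {t : ℝ} (ht : t ∈ U)
    (x : ℝ) :
    deriv (fun s => deriv (F s) x) t = deriv (fun y => deriv (fun s => F s y) t) x := by
  have hmem : ((t, x) : ℝ × ℝ) ∈ U ×ˢ (univ : Set ℝ) := ⟨ht, mem_univ _⟩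
  have hnhds := (hU.prod isOpen_univ).mem_nhds hmem
  have hsymm := (hF.contDiffAt hnhds).isSymmSndFDerivAt
    (by simpa using two_le_coe_top)
  have hdd : DifferentiableAt ℝ (fderiv ℝ (fun p : ℝ × ℝ => F p.1 p.2)) (t, x) :=
    ((hF.fderiv_of_isOpen (m := (⊤ : ℕ∞)) (hU.prod isOpen_univ) (by simp)).differentiableOn
      (by simp)).differentiableAt hnhds
  have h1 : (fun s => deriv (F s) x) =ᶠ[nhds t]
      fun s => fderiv ℝ (fun p : ℝ × ℝ => F p.1 p.2) (s, x) (0, 1) := by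
    filter_upwards [hU.mem_nhds ht] with s hs
    exact (hasDerivAt_slice_space_of_isOpen hU (by simp) hF hs x).deriv
  have h2 : (fun y => deriv (fun s => F s y) t) =
      fun y => fderiv ℝ (fun p : ℝ × ℝ => F p.1 p.2) (t, y) (1, 0) := by
    ext y
    exact (hasDerivAt_slice_time hU (by simp) hF ht y).deriv
  rw [h1.deriv_eq, h2]
  have e1 : HasDerivAt (fun s => fderiv ℝ (fun p : ℝ × ℝ => F p.1 p.2) (s, x))
      (fderiv ℝ (fderiv ℝ (fun p : ℝ × ℝ => F p.1 p.2)) (t, x) (1, 0)) t :=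
    hdd.hasFDerivAt.comp_hasDerivAt t ((hasDerivAt_id t).prodMk (hasDerivAt_const t x))
  have e2 : HasDerivAt (fun y => fderiv ℝ (fun p : ℝ × ℝ => F p.1 p.2) (t, y))
      (fderiv ℝ (fderiv ℝ (fun p : ℝ × ℝ => F p.1 p.2)) (t, x) (0, 1)) x :=
    hdd.hasFDerivAt.comp_hasDerivAt x ((hasDerivAt_const x t).prodMk (hasDerivAt_id x))
  have e1' := (e1.clm_apply (hasDerivAt_const t ((0 : ℝ), (1 : ℝ)))).deriv
  have e2' := (e2.clm_apply (hasDerivAt_const x ((1 : ℝ), (0 : ℝ)))).deriv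
  rw [e1', e2', map_zero, add_zero, add_zero]
  exact hsymm _ _

lemma continuousOn_integral_slice {S : Set ℝ} {e : ℝ → ℝ → ℝ}
    (he : ContinuousOn (fun p : ℝ × ℝ => e p.1 p.2) (S ×ˢ univ)) :
    ContinuousOn (fun t => ∫ x in (0 : ℝ)..1, e t x) S := by
  rw [continuousOn_iff_continuous_domRestrict]
  refine intervalIntegral.continuous_parametric_intervalIntegral_of_continuous'
    (f := fun (t : S) x => e t x) ?_ 0 1
  exact he.comp_continuous (f := fun p : S × ℝ => ((p.1 : ℝ), p.2)) (by fun_prop)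
    (fun p => ⟨p.1.2, mem_univ _⟩)

/-- A density satisfying a conservation law with nonpositive source has nonincreasing integral. -/
lemma integral_le_initial_of_balance {T : ℝ} {e Φ : ℝ → ℝ → ℝ}
    (hcont : ContinuousOn (fun p : ℝ × ℝ => e p.1 p.2) (Ico 0 T ×ˢ univ))
    (he : ContDiffOn ℝ 1 (fun p : ℝ × ℝ => e p.1 p.2) (Ioo 0 T ×ˢ univ))
    (hΦ : ContDiffOn ℝ 1 (fun p : ℝ × ℝ => Φ p.1 p.2) (Ioo 0 T ×ˢ univ))
    (hper : ∀ t ∈ Ioo 0 T, Φ t 1 = Φ t 0)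
    (hle : ∀ t ∈ Ioo 0 T, ∀ x, deriv (fun s => e s x) t + deriv (Φ t) x ≤ 0)
    {t : ℝ} (ht : t ∈ Ico 0 T) :
    ∫ x in (0 : ℝ)..1, e t x ≤ ∫ x in (0 : ℝ)..1, e 0 x := by
  rcases ht.1.eq_or_lt with rfl | ht0
  · exact le_rfl
  have hopen : IsOpen (Ioo 0 T ×ˢ (univ : Set ℝ)) := isOpen_Ioo.prod isOpen_univ
  have key : ∀ a ∈ Ioo 0 t, ∫ x in (0 : ℝ)..1, e t x ≤ ∫ x in (0 : ℝ)..1, e a x := by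
    intro a ha
    have hsub : Icc (a, (0 : ℝ)) (t, 1) ⊆ Ioo 0 T ×ˢ (univ : Set ℝ) := fun p hp =>
      ⟨⟨ha.1.trans_le hp.1.1, hp.2.1.trans_lt ht.2⟩, mem_univ _⟩
    have hsub' : Ioo a t ×ˢ Ioo (0 : ℝ) 1 ⊆ Ioo 0 T ×ˢ (univ : Set ℝ) := fun p hp =>
      ⟨⟨ha.1.trans hp.1.1, hp.1.2.trans ht.2⟩, mem_univ _⟩
    have hcd := ((he.continuousOn_fderiv_of_isOpen hopen le_rfl).clm_apply
      (continuousOn_const (c := ((1 : ℝ), (0 : ℝ))))).add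
      ((hΦ.continuousOn_fderiv_of_isOpen hopen le_rfl).clm_apply
      (continuousOn_const (c := ((0 : ℝ), (1 : ℝ)))))
    have hdiv := integral_divergence_prod_Icc_of_hasFDerivAt_of_le
      (fun p : ℝ × ℝ => e p.1 p.2) (fun p : ℝ × ℝ => Φ p.1 p.2)
      (fderiv ℝ (fun p : ℝ × ℝ => e p.1 p.2)) (fderiv ℝ (fun p : ℝ × ℝ => Φ p.1 p.2))
      (a, 0) (t, 1) ⟨ha.2.le, zero_le_one⟩ (he.continuousOn.mono hsub) (hΦ.continuousOn.mono hsub)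
      (fun p hp => ((he.differentiableOn one_ne_zero).differentiableAt
        (hopen.mem_nhds (hsub' hp))).hasFDerivAt)
      (fun p hp => ((hΦ.differentiableOn one_ne_zero).differentiableAt
        (hopen.mem_nhds (hsub' hp))).hasFDerivAt)
      ((hcd.mono hsub).integrableOn_compact isCompact_Icc)
    have hneg : ∫ p in Icc (a, (0 : ℝ)) (t, 1), fderiv ℝ (fun p : ℝ × ℝ => e p.1 p.2) p (1, 0) +
        fderiv ℝ (fun p : ℝ × ℝ => Φ p.1 p.2) p (0, 1) ≤ 0 := by
      refine setIntegral_nonpos measurableSet_Icc fun p hp => ?_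
      have h := hle p.1 (hsub hp).1 p.2
      rw [(hasDerivAt_slice_time isOpen_Ioo one_ne_zero he (hsub hp).1 p.2).deriv,
        (hasDerivAt_slice_space_of_isOpen isOpen_Ioo one_ne_zero hΦ (hsub hp).1 p.2).deriv] at h
      exact h
    have hflux : ∫ s in a..t, Φ s 1 = ∫ s in a..t, Φ s 0 := by
      refine intervalIntegral.integral_congr fun s hs => ?_
      rw [uIcc_of_le ha.2.le] at hs
      exact hper s ⟨ha.1.trans_le hs.1, hs.2.trans_lt ht.2⟩
    simp only at hdiv
    linarith
  have hlim : Tendsto (fun a => ∫ x in (0 : ℝ)..1, e a x) (nhdsWithin 0 (Ioo 0 t))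
      (nhds (∫ x in (0 : ℝ)..1, e 0 x)) :=
    ((continuousOn_integral_slice hcont) 0 ⟨le_rfl, ht0.trans ht.2⟩).mono_left
      (nhdsWithin_mono 0 fun s hs => ⟨hs.1.le, hs.2.trans ht.2⟩)
  have : (nhdsWithin 0 (Ioo 0 t)).NeBot := by
    rw [← mem_closure_iff_nhdsWithin_neBot, closure_Ioo ht0.ne]
    exact ⟨le_rfl, ht0.le⟩
  exact ge_of_tendsto hlim (eventually_nhdsWithin_of_forall key)

/-- A pressure potential of an admissible pair grows at least quadratically. -/
lemma IsPressurePotential.exists_quadratic_lower_bound {P W : ℝ → ℝ} {γ β a : ℝ}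
    (hP : IsAdmissiblePair P γ β a) (hW : IsPressurePotential P W) :
    ∃ δ C : ℝ, 0 < δ ∧ ∀ r, 0 < r → δ * r ^ 2 - C ≤ W r := by
  have ha := hP.a_pos
  obtain ⟨R₀, hR₀⟩ := eventually_atTop.1 (hP.lim.eventually (lt_mem_nhds (half_lt_self ha)))
  set R := max R₀ 1
  have hR1 : 1 ≤ R := le_max_right _ _
  have hWd : ∀ r, 0 < r → HasDerivAt W (deriv W r) r := fun r hr =>
    ((hW.smooth.differentiableOn (by simp)).differentiableAt (Ioi_mem_nhds hr)).hasDerivAt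
  have hWc : ContDiffOn ℝ 1 (deriv W) (Ioi 0) := hW.smooth.deriv_of_isOpen isOpen_Ioi (by norm_num)
  have hWdd : ∀ r, 0 < r → HasDerivAt (deriv W) (deriv (deriv W) r) r := fun r hr =>
    ((hWc.differentiableOn (by simp)).differentiableAt (Ioi_mem_nhds hr)).hasDerivAt
  have hlow : ∀ r, R ≤ r → a / 2 ≤ deriv (deriv W) r := by
    intro r hr
    have hr1 : 1 ≤ r := hR1.trans hr
    have hr0 : 0 < r := by linarith
    have h1 := hR₀ r ((le_max_left _ _).trans hr)
    have hpow : r ≤ r ^ (β - 1) := by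
      simpa using Real.rpow_le_rpow_of_exponent_le hr1
        (show (1 : ℝ) ≤ β - 1 by linarith [hP.beta_ge])
    rw [lt_div_iff₀ (hr0.trans_le hpow), ← hW.relation r hr0] at h1
    have : a / 2 * r ≤ deriv (deriv W) r * r :=
      (mul_le_mul_of_nonneg_left hpow (by positivity)).trans h1.le
    exact le_of_mul_le_mul_right this hr0
  have hmono1 : ∀ r, R ≤ r → deriv W R - a / 2 * R ≤ deriv W r - a / 2 * r := by
    have hd : ∀ r, R ≤ r →
        HasDerivAt (fun r => deriv W r - a / 2 * r) (deriv (deriv W) r - a / 2 * 1) r :=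
      fun r hr => (hWdd r (by linarith)).sub ((hasDerivAt_id r).const_mul (a / 2))
    have : MonotoneOn (fun r => deriv W r - a / 2 * r) (Ici R) := by
      refine monotoneOn_of_hasDerivWithinAt_nonneg (convex_Ici R)
        (fun r hr => (hd r hr).continuousAt.continuousWithinAt)
        (fun r hr => (hd r (interior_subset hr)).hasDerivWithinAt) fun r hr => ?_
      linarith [hlow r (interior_subset hr)]
    exact fun r hr => this self_mem_Ici hr hr
  set m := deriv W R - a / 2 * R
  have hmono2 : ∀ r, R ≤ r → W R - a / 4 * R ^ 2 - m * R ≤ W r - a / 4 * r ^ 2 - m * r := by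
    have hd : ∀ r, R ≤ r → HasDerivAt (fun r => W r - a / 4 * r ^ 2 - m * r)
        (deriv W r - a / 4 * (2 * r) - m * 1) r := by
      intro r hr
      refine ((hWd r (by linarith)).sub (HasDerivAt.const_mul (a / 4) ?_)).sub
        ((hasDerivAt_id r).const_mul m)
      simpa using hasDerivAt_pow 2 r
    have : MonotoneOn (fun r => W r - a / 4 * r ^ 2 - m * r) (Ici R) := by
      refine monotoneOn_of_hasDerivWithinAt_nonneg (convex_Ici R)
        (fun r hr => (hd r hr).continuousAt.continuousWithinAt)
        (fun r hr => (hd r (interior_subset hr)).hasDerivWithinAt) fun r hr => ?_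
      linarith [hmono1 r (interior_subset hr)]
    exact fun r hr => this self_mem_Ici hr hr
  refine ⟨a / 8, max (a / 8 * R ^ 2) (2 * m ^ 2 / a - (W R - a / 4 * R ^ 2 - m * R)),
    by positivity, fun r hr => ?_⟩
  rcases le_total R r with h | h
  · have h2 := hmono2 r h
    have h3 := le_max_right (a / 8 * R ^ 2) (2 * m ^ 2 / a - (W R - a / 4 * R ^ 2 - m * R))
    have h4 : 0 ≤ a / 8 * r ^ 2 + m * r + 2 * m ^ 2 / a := by
      have : a / 8 * r ^ 2 + m * r + 2 * m ^ 2 / a = (a * r + 4 * m) ^ 2 / (8 * a) := by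
        field_simp
        ring
      rw [this]
      positivity
    linarith
  · have h3 := le_max_left (a / 8 * R ^ 2) (2 * m ^ 2 / a - (W R - a / 4 * R ^ 2 - m * R))
    have h4 : a / 8 * r ^ 2 ≤ a / 8 * R ^ 2 := by gcongr
    linarith [hW.nonneg r hr.le]

lemma LinfNorm_le_of_contDiff {f : ℝ → ℝ} (hf : ContDiff ℝ 1 f) :
    LinfNorm f ≤ 1 + ((∫ x in (0 : ℝ)..1, f x ^ 2) + ∫ x in (0 : ℝ)..1, deriv f x ^ 2) / 2 := by
  have hc : Continuous f := hf.continuous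
  have hd : Continuous (deriv f) := hf.continuous_deriv le_rfl
  have habs : ∀ g : ℝ → ℝ, Continuous g →
      ∫ x in (0 : ℝ)..1, |g x| ≤ (1 + ∫ x in (0 : ℝ)..1, g x ^ 2) / 2 := by
    intro g hg
    have hi : IntervalIntegrable (fun x => g x ^ 2) volume 0 1 :=
      (hg.pow 2).intervalIntegrable 0 1
    calc ∫ x in (0 : ℝ)..1, |g x| ≤ ∫ x in (0 : ℝ)..1, (1 + g x ^ 2) / 2 := by
          refine intervalIntegral.integral_mono_on zero_le_one (hg.abs.intervalIntegrable 0 1)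
            (Continuous.intervalIntegrable (by fun_prop) 0 1) fun x _ => ?_
          nlinarith [sq_nonneg (|g x| - 1), sq_abs (g x)]
      _ = _ := by
          rw [intervalIntegral.integral_div, intervalIntegral.integral_add (by simp) hi]
          simp
  have hosc : ∀ x ∈ Icc (0 : ℝ) 1, ∀ y ∈ Icc (0 : ℝ) 1,
      |f x| ≤ |f y| + ∫ z in (0 : ℝ)..1, |deriv f z| := by
    intro x hx y hy
    have h1 : ∫ z in y..x, deriv f z = f x - f y :=
      intervalIntegral.integral_deriv_eq_sub
        (fun z _ => (hf.differentiable one_ne_zero).differentiableAt) (hd.intervalIntegrable y x)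
    have h2 : |f x - f y| ≤ ∫ z in (0 : ℝ)..1, |deriv f z| := by
      rw [← h1, ← Real.norm_eq_abs, intervalIntegral.integral_of_le zero_le_one]
      refine (intervalIntegral.norm_integral_le_integral_norm_uIoc).trans ?_
      refine setIntegral_mono_set (hd.abs.integrableOn_Ioc) (ae_of_all _ fun z => abs_nonneg _)
        (LE.le.eventuallyLE ?_)
      exact Ioc_subset_Ioc (le_min hy.1 hx.1) (max_le hy.2 hx.2)
    have h3 : |f x| ≤ |f y| + |f x - f y| := by
      simpa using abs_add_le (f y) (f x - f y)
    linarith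
  refine csSup_le ⟨_, 0, by simp, rfl⟩ ?_
  rintro _ ⟨x, hx, rfl⟩
  have h := intervalIntegral.integral_mono_on (f := fun _ : ℝ => |f x|)
    (g := fun y => |f y| + ∫ z in (0 : ℝ)..1, |deriv f z|) (a := 0) (b := 1) (μ := volume)
    zero_le_one (by simp) (Continuous.intervalIntegrable (by fun_prop) 0 1) (hosc x hx)
  rw [intervalIntegral.integral_add (hc.abs.intervalIntegrable 0 1) (by simp)] at h
  simp only [intervalIntegral.integral_const, sub_zero, one_smul] at h
  linarith [habs f hc, habs _ hd]

lemma integral_deriv_eq_zero_of_periodic {f : ℝ → ℝ} (hf : ContDiff ℝ 1 f)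
    (hper : ∀ x, f (x + 1) = f x) : ∫ x in (0 : ℝ)..1, deriv f x = 0 := by
  rw [intervalIntegral.integral_deriv_eq_sub
    (fun z _ => (hf.differentiable one_ne_zero).differentiableAt)
    ((hf.continuous_deriv le_rfl).intervalIntegrable _ _)]
  simpa [sub_eq_zero] using hper 0

lemma deriv_periodic {f : ℝ → ℝ} (hper : ∀ x, f (x + 1) = f x) (x : ℝ) :
    deriv f (x + 1) = deriv f x := by
  rw [← deriv_comp_add_const f 1 x]
  simp only [hper]

/-- Energy estimate for the screened Poisson equation `-κ ∂²c + γ (c - r) = 0`. -/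
lemma elliptic_energy_le {κ γ : ℝ} {r c : ℝ → ℝ} (hγ : 0 < γ) (hκ : 0 < κ)
    (hr : Continuous r) (hc : ContDiff ℝ 2 c) (hper : ∀ x, c (x + 1) = c x)
    (heq : ∀ x, -κ * deriv (deriv c) x + γ * (c x - r x) = 0) :
    γ * (∫ x in (0 : ℝ)..1, (c x - r x) ^ 2) + κ * (∫ x in (0 : ℝ)..1, deriv c x ^ 2) ≤
      γ * ∫ x in (0 : ℝ)..1, r x ^ 2 := by
  have hcc : Continuous c := hc.continuous
  have hc1 : ContDiff ℝ 1 c := hc.of_le (by norm_num)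
  have hcd : ContDiff ℝ 1 (deriv c) := hc.deriv'
  have hcdc : Continuous (deriv c) := hcd.continuous
  have hIcc : IntervalIntegrable (fun x => c x ^ 2) volume 0 1 :=
    Continuous.intervalIntegrable (by fun_prop) 0 1
  have hIcd : IntervalIntegrable (fun x => deriv c x ^ 2) volume 0 1 :=
    Continuous.intervalIntegrable (by fun_prop) 0 1
  have hIrr : IntervalIntegrable (fun x => r x ^ 2) volume 0 1 :=
    Continuous.intervalIntegrable (by fun_prop) 0 1
  have hIcr : IntervalIntegrable (fun x => (c x - r x) ^ 2) volume 0 1 :=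
    Continuous.intervalIntegrable (by fun_prop) 0 1
  have hdiv := integral_deriv_eq_zero_of_periodic (f := c * deriv c) (hc1.mul hcd)
    (fun x => by simp only [hper, deriv_periodic hper, Pi.mul_apply])
  have hd : ∀ x, κ * deriv (c * deriv c) x = κ * deriv c x ^ 2 + γ * (c x * (c x - r x)) := by
    intro x
    rw [deriv_mul (hc1.differentiable one_ne_zero).differentiableAt
      (hcd.differentiable one_ne_zero).differentiableAt]
    linear_combination -(c x) * heq x
  have hzero : ∫ x in (0 : ℝ)..1, (κ * deriv c x ^ 2 + γ * (c x * (c x - r x))) = 0 := by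
    simp_rw [← hd]
    rw [intervalIntegral.integral_const_mul, hdiv, mul_zero]
  have hle : ∫ x in (0 : ℝ)..1, (γ * (c x - r x) ^ 2 + κ * deriv c x ^ 2) ≤
      ∫ x in (0 : ℝ)..1, (γ * r x ^ 2 + 2 * (κ * deriv c x ^ 2 + γ * (c x * (c x - r x)))) := by
    refine intervalIntegral.integral_mono_on zero_le_one
      (Continuous.intervalIntegrable (by fun_prop) 0 1)
      (Continuous.intervalIntegrable (by fun_prop) 0 1) fun x _ => ?_
    nlinarith [mul_nonneg hγ.le (sq_nonneg (c x)), mul_nonneg hκ.le (sq_nonneg (deriv c x))]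
  rw [intervalIntegral.integral_add (hIcr.const_mul γ) (hIcd.const_mul κ),
    intervalIntegral.integral_add (hIrr.const_mul γ)
      (Continuous.intervalIntegrable (by fun_prop) 0 1)] at hle
  simp only [intervalIntegral.integral_const_mul, hzero] at hle
  linarith

/-- All norms in the density and order parameter bound are controlled by `∫ r²`. -/
lemma norms_le_of_integral_sq_le {κ γ X : ℝ} {r c : ℝ → ℝ} (hγ : 0 < γ) (hκ : 0 < κ)
    (hr : Continuous r) (hc : ContDiff ℝ 2 c) (hper : ∀ x, c (x + 1) = c x)
    (heq : ∀ x, -κ * deriv (deriv c) x + γ * (c x - r x) = 0)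
    (hX : ∫ x in (0 : ℝ)..1, r x ^ 2 ≤ X) :
    L2norm r + W1infNorm c + H2norm c ≤ Real.sqrt X +
      (2 + (4 + 2 * (γ / κ) + (γ / κ) ^ 2) / 2 * X) +
      Real.sqrt ((4 + γ / κ + (γ / κ) ^ 2) * X) := by
  have hcc : Continuous c := hc.continuous
  have hc1 : ContDiff ℝ 1 c := hc.of_le (by norm_num)
  have hcd : ContDiff ℝ 1 (deriv c) := hc.deriv'
  have hcdc : Continuous (deriv c) := hcd.continuous
  have hcddc : Continuous (deriv (deriv c)) := hcd.continuous_deriv le_rfl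
  have hE := elliptic_energy_le hγ hκ hr hc hper heq
  have hIcc : IntervalIntegrable (fun x => c x ^ 2) volume 0 1 :=
    Continuous.intervalIntegrable (by fun_prop) 0 1
  have hIcd : IntervalIntegrable (fun x => deriv c x ^ 2) volume 0 1 :=
    Continuous.intervalIntegrable (by fun_prop) 0 1
  have hIcdd : IntervalIntegrable (fun x => deriv (deriv c) x ^ 2) volume 0 1 :=
    Continuous.intervalIntegrable (by fun_prop) 0 1
  have hIrr : IntervalIntegrable (fun x => r x ^ 2) volume 0 1 :=
    Continuous.intervalIntegrable (by fun_prop) 0 1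
  have hIcr : IntervalIntegrable (fun x => (c x - r x) ^ 2) volume 0 1 :=
    Continuous.intervalIntegrable (by fun_prop) 0 1
  have hnn : ∀ f : ℝ → ℝ, 0 ≤ ∫ x in (0 : ℝ)..1, f x ^ 2 := fun f =>
    intervalIntegral.integral_nonneg zero_le_one fun x _ => sq_nonneg _
  have hD : ∫ x in (0 : ℝ)..1, deriv c x ^ 2 ≤ γ / κ * X := by
    rw [div_mul_eq_mul_div, le_div_iff₀ hκ]
    nlinarith [hnn fun x => c x - r x]
  have hA : ∫ x in (0 : ℝ)..1, (c x - r x) ^ 2 ≤ X := by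
    have : γ * (∫ x in (0 : ℝ)..1, (c x - r x) ^ 2) ≤ γ * X := by
      nlinarith [hnn (deriv c)]
    exact le_of_mul_le_mul_left this hγ
  have hB : ∫ x in (0 : ℝ)..1, c x ^ 2 ≤ 4 * X := by
    have : ∫ x in (0 : ℝ)..1, c x ^ 2 ≤ ∫ x in (0 : ℝ)..1, (2 * (c x - r x) ^ 2 + 2 * r x ^ 2) := by
      refine intervalIntegral.integral_mono_on zero_le_one hIcc
        (Continuous.intervalIntegrable (by fun_prop) 0 1) fun x _ => ?_
      nlinarith [sq_nonneg (c x - r x - r x)]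
    rw [intervalIntegral.integral_add (hIcr.const_mul 2) (hIrr.const_mul 2)] at this
    simp only [intervalIntegral.integral_const_mul] at this
    linarith
  have hF : ∫ x in (0 : ℝ)..1, deriv (deriv c) x ^ 2 ≤ (γ / κ) ^ 2 * X := by
    have : ∀ x, deriv (deriv c) x ^ 2 = (γ / κ) ^ 2 * (c x - r x) ^ 2 := by
      intro x
      have h : deriv (deriv c) x = γ / κ * (c x - r x) := by
        field_simp
        linarith [heq x]
      rw [h, mul_pow]
    simp_rw [this]
    rw [intervalIntegral.integral_const_mul]
    gcongr
  have h1 : L2norm r ≤ Real.sqrt X := Real.sqrt_le_sqrt hX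
  have h2 := LinfNorm_le_of_contDiff hc1
  have h3 := LinfNorm_le_of_contDiff hcd
  have h4 : H2norm c ≤ Real.sqrt ((4 + γ / κ + (γ / κ) ^ 2) * X) := by
    refine Real.sqrt_le_sqrt ?_
    rw [intervalIntegral.integral_add (hIcc.add hIcd) hIcdd,
      intervalIntegral.integral_add hIcc hIcd]
    linarith
  unfold W1infNorm
  linarith

/-- The total energy of a solution is bounded by its initial value. -/
lemma IsNSKSolution.energy_le {μ κ γ T β a : ℝ} {P W : ℝ → ℝ} {ρ u c : ℝ → ℝ → ℝ}
    {ρ₀ u₀ : ℝ → ℝ} (hμ : 0 < μ) (hP : IsAdmissiblePair P γ β a) (hW : IsPressurePotential P W)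
    (h : IsNSKSolution μ κ γ P (Ico 0 T) ρ u c ρ₀ u₀) {t : ℝ} (ht : t ∈ Ico 0 T) :
    ∫ x in (0 : ℝ)..1, (ρ t x * u t x ^ 2 / 2 + W (ρ t x) + γ / 2 * (c t x - ρ t x) ^ 2 +
        κ / 2 * deriv (c t) x ^ 2) ≤
      ∫ x in (0 : ℝ)..1, (ρ 0 x * u 0 x ^ 2 / 2 + W (ρ 0 x) + γ / 2 * (c 0 x - ρ 0 x) ^ 2 +
        κ / 2 * deriv (c 0) x ^ 2) := by
  have hU : IsOpen (Ioo 0 T) := isOpen_Ioo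
  have hsub : Ioo 0 T ×ˢ (univ : Set ℝ) ⊆ Ico 0 T ×ˢ univ := prod_mono Ioo_subset_Ico_self le_rfl
  have hρ := h.smooth_rho
  have hu := h.smooth_u
  have hc := h.smooth_c
  have hcx := contDiffOn_deriv_space (uniqueDiffOn_Ico 0 T) hc
  have hWρ : ContDiffOn ℝ 2 (fun p : ℝ × ℝ => W (ρ p.1 p.2)) (Ico 0 T ×ˢ univ) :=
    hW.smooth.comp (hρ.of_le two_le_coe_top) fun p _ => h.rho_pos p.1 p.2
  have hWc : ContDiffOn ℝ 1 (deriv W) (Ioi 0) := hW.smooth.deriv_of_isOpen isOpen_Ioi (by norm_num)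
  have hρ' := hρ.mono hsub
  have hu' := hu.mono hsub
  have hc' := hc.mono hsub
  have hcx' := hcx.mono hsub
  have hux' := contDiffOn_deriv_space hU.uniqueDiffOn hu'
  have hct' := contDiffOn_deriv_time hU hc'
  have hW'ρ : ContDiffOn ℝ 1 (fun p : ℝ × ℝ => deriv W (ρ p.1 p.2)) (Ioo 0 T ×ˢ univ) :=
    hWc.comp (hρ'.of_le (by exact_mod_cast le_top)) fun p _ => h.rho_pos p.1 p.2
  have one_le : (1 : WithTop ℕ∞) ≤ ((⊤ : ℕ∞) : WithTop ℕ∞) := by exact_mod_cast le_top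
  have he : ContDiffOn ℝ 1 (fun p : ℝ × ℝ => ρ p.1 p.2 * u p.1 p.2 ^ 2 / 2 + W (ρ p.1 p.2) +
      γ / 2 * (c p.1 p.2 - ρ p.1 p.2) ^ 2 + κ / 2 * deriv (c p.1) p.2 ^ 2) (Ico 0 T ×ˢ univ) := by
    have a1 := hρ.of_le one_le
    have a2 := hu.of_le one_le
    have a3 := hc.of_le one_le
    have a4 := hcx.of_le one_le
    have a5 : ContDiffOn ℝ 1 (fun p : ℝ × ℝ => W (ρ p.1 p.2)) (Ico 0 T ×ˢ univ) :=
      hWρ.of_le (by norm_num)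
    exact ((((a1.mul (a2.pow 2)).div_const 2).add a5).add
      (contDiffOn_const.mul ((a3.sub a1).pow 2))).add (contDiffOn_const.mul (a4.pow 2))
  refine integral_le_initial_of_balance
    (e := fun t x => ρ t x * u t x ^ 2 / 2 + W (ρ t x) + γ / 2 * (c t x - ρ t x) ^ 2 +
      κ / 2 * deriv (c t) x ^ 2)
    (Φ := fun t x => ρ t x * u t x ^ 3 / 2 + deriv W (ρ t x) * (ρ t x * u t x) -
      μ * (u t x * deriv (u t) x) - γ * ((c t x - ρ t x) * (ρ t x * u t x)) -
      κ * (deriv (c t) x * deriv (fun s => c s x) t)) he.continuousOn (he.mono hsub) ?_ ?_ ?_ ht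
  · have a1 := hρ'.of_le one_le
    have a2 := hu'.of_le one_le
    have a3 := hc'.of_le one_le
    have a4 := hcx'.of_le one_le
    have a5 := hux'.of_le one_le
    have a6 := hct'.of_le one_le
    exact (((((a1.mul (a2.pow 3)).div_const 2).add (hW'ρ.mul (a1.mul a2))).sub
      (contDiffOn_const.mul (a2.mul a5))).sub
      (contDiffOn_const.mul ((a3.sub a1).mul (a1.mul a2)))).sub (contDiffOn_const.mul (a4.mul a6))
  · intro t ht
    have e1 := h.periodic_rho t 0
    have e2 := h.periodic_u t 0
    have e3 := h.periodic_c t 0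
    have e4 := deriv_periodic (h.periodic_u t) 0
    have e5 := deriv_periodic (h.periodic_c t) 0
    have e6 : (fun s => c s (0 + 1)) = fun s => c s 0 := funext fun s => h.periodic_c s 0
    rw [zero_add] at e1 e2 e3 e4 e5 e6
    simp only [e1, e2, e3, e4, e5, e6]
  · intro t ht x
    have ht' : t ∈ Ico 0 T := Ioo_subset_Ico_self ht
    have htop : ((⊤ : ℕ∞) : WithTop ℕ∞) ≠ 0 := by simp
    have ρx := (hasDerivAt_slice_space_of_isOpen hU htop hρ' ht x).differentiableAt.hasDerivAt
    have ux := (hasDerivAt_slice_space_of_isOpen hU htop hu' ht x).differentiableAt.hasDerivAt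
    have cx := (hasDerivAt_slice_space_of_isOpen hU htop hc' ht x).differentiableAt.hasDerivAt
    have uxx := (hasDerivAt_slice_space_of_isOpen hU htop
      (F := fun t x => deriv (u t) x) hux' ht x).differentiableAt.hasDerivAt
    have cxx := (hasDerivAt_slice_space_of_isOpen hU htop
      (F := fun t x => deriv (c t) x) hcx' ht x).differentiableAt.hasDerivAt
    have ctx := (hasDerivAt_slice_space_of_isOpen hU htop
      (F := fun t x => deriv (fun s => c s x) t) hct' ht x).differentiableAt.hasDerivAt
    have ρt := (hasDerivAt_slice_time hU htop hρ' ht x).differentiableAt.hasDerivAt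
    have ut := (hasDerivAt_slice_time hU htop hu' ht x).differentiableAt.hasDerivAt
    have ct := (hasDerivAt_slice_time hU htop hc' ht x).differentiableAt.hasDerivAt
    have cxt := (hasDerivAt_slice_time hU htop
      (F := fun t x => deriv (c t) x) hcx' ht x).differentiableAt.hasDerivAt
    rw [deriv_time_deriv_space hU hc' ht x] at cxt
    have hpos := h.rho_pos t x
    have hPd : HasDerivAt P (deriv P (ρ t x)) (ρ t x) :=
      ((hP.smooth.differentiableOn one_ne_zero).differentiableAt (Ici_mem_nhds hpos)).hasDerivAt
    have hWd : HasDerivAt W (deriv W (ρ t x)) (ρ t x) :=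
      ((hW.smooth.differentiableOn (by simp)).differentiableAt (Ioi_mem_nhds hpos)).hasDerivAt
    have hWdd : HasDerivAt (deriv W) (deriv (deriv W) (ρ t x)) (ρ t x) :=
      ((hWc.differentiableOn (by simp)).differentiableAt (Ioi_mem_nhds hpos)).hasDerivAt
    have hPx : HasDerivAt (fun y => P (ρ t y)) (deriv P (ρ t x) * deriv (ρ t) x) x :=
      hPd.comp x ρx
    have hmass := h.mass t ht' x
    rw [(ρx.fun_mul ux).deriv] at hmass
    have hmom := h.momentum t ht' x
    rw [(ρt.fun_mul ut).deriv, (ρx.fun_mul (ux.fun_pow 2)).deriv, hPx.deriv,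
      (cx.fun_sub ρx).deriv] at hmom
    have hell := h.elliptic t ht' x
    have hrel := hW.relation (ρ t x) hpos
    have het := (((((ρt.fun_mul (ut.fun_pow 2)).div_const 2).fun_add (hWd.comp t ρt)).fun_add
      (((ct.fun_sub ρt).fun_pow 2).const_mul (γ / 2))).fun_add ((cxt.fun_pow 2).const_mul (κ / 2)))
    have hΦx := ((((((ρx.fun_mul (ux.fun_pow 3)).div_const 2).fun_add
      ((hWdd.comp x ρx).fun_mul (ρx.fun_mul ux))).fun_sub
      ((ux.fun_mul uxx).const_mul μ)).fun_sub
      (((cx.fun_sub ρx).fun_mul (ρx.fun_mul ux)).const_mul γ)).fun_sub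
      ((cxx.fun_mul ctx).const_mul κ))
    have hbal : ∀ A B : ℝ, A + B = -μ * deriv (u t) x ^ 2 → A + B ≤ 0 := fun A B hAB => by
      rw [hAB]
      nlinarith [mul_nonneg hμ.le (sq_nonneg (deriv (u t) x))]
    refine hbal _ _ ?_
    refine (congrArg₂ (· + ·) het.deriv hΦx.deriv).trans ?_
    simp only [Function.comp_apply] at hmom ⊢
    push_cast at hmom ⊢
    linear_combination u t x * hmom +
      (-(u t x ^ 2) / 2 + deriv W (ρ t x) - γ * (c t x - ρ t x)) * hmass +
      deriv (ρ t) x * u t x * hrel + deriv (fun s => c s x) t * hell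

/-- Uniform control of the density and the order parameter: there is a constant
`E₁ ≥ 0`, depending only on `M₀`, `‖u₀‖_{L²(𝕋)}`, `μ`, `γ`, `κ` and `W`, such that
`‖ρ(t,·)‖_{L²} + ‖c(t,·)‖_{W^{1,∞}} + ‖c(t,·)‖_{H²} ≤ E₁` for all `t ∈ [0,T)`. -/
theorem density_order_parameter_bound :
    ∃ E : ℝ → ℝ → ℝ → ℝ → ℝ → (ℝ → ℝ) → ℝ,
      ∀ (μ κ γ M₀ T β a : ℝ) (P W : ℝ → ℝ) (ρ u c : ℝ → ℝ → ℝ) (ρ₀ u₀ : ℝ → ℝ),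
        0 < μ → 0 < κ → 0 < γ → 0 < M₀ → 0 < T →
        IsAdmissiblePair P γ β a → IsPressurePotential P W →
        IsNSKSolution μ κ γ P (Set.Ico 0 T) ρ u c ρ₀ u₀ →
        (∀ x : ℝ, M₀⁻¹ ≤ ρ₀ x ∧ ρ₀ x ≤ M₀) →
        0 ≤ E M₀ (L2norm u₀) μ γ κ W ∧
        ∀ t ∈ Set.Ico 0 T,
          L2norm (ρ t) + W1infNorm (c t) + H2norm (c t) ≤ E M₀ (L2norm u₀) μ γ κ W := by
  classical
  have hquad : ∀ W : ℝ → ℝ, ∃ q : ℝ × ℝ, (∃ P γ β a, IsAdmissiblePair P γ β a ∧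
      IsPressurePotential P W) → 0 < q.1 ∧ ∀ r, 0 < r → q.1 * r ^ 2 - q.2 ≤ W r := by
    intro W
    by_cases hex : ∃ P γ β a, IsAdmissiblePair P γ β a ∧ IsPressurePotential P W
    · obtain ⟨P, γ, β, a, hP, hW⟩ := hex
      obtain ⟨δ, C, h⟩ := hW.exists_quadratic_lower_bound hP
      exact ⟨(δ, C), fun _ => h⟩
    · exact ⟨0, fun h => absurd h hex⟩
  choose q hq using hquad
  let K : (ℝ → ℝ) → ℝ → ℝ := fun W M => sSup (W '' Icc M⁻¹ M)
  let X : ℝ → ℝ → ℝ → (ℝ → ℝ) → ℝ := fun M A γ W =>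
    (M * A ^ 2 / 2 + K W M + γ / 2 * M ^ 2 + (q W).2) / (q W).1
  refine ⟨fun M A _ γ κ W => Real.sqrt (X M A γ W) +
      (2 + (4 + 2 * (γ / κ) + (γ / κ) ^ 2) / 2 * X M A γ W) +
      Real.sqrt ((4 + γ / κ + (γ / κ) ^ 2) * X M A γ W), ?_⟩
  intro μ κ γ M₀ T β a P W ρ u c ρ₀ u₀ hμ hκ hγ hM hT hP hW h hinit
  obtain ⟨hδ, hlow⟩ := hq W ⟨P, γ, β, a, hP, hW⟩
  have hWcont : ContinuousOn W (Ioi 0) := hW.smooth.continuousOn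
  have hρc : ∀ t ∈ Ico 0 T, Continuous (ρ t) := fun t ht =>
    (contDiff_slice_space h.smooth_rho ht).continuous
  have huc : ∀ t ∈ Ico 0 T, Continuous (u t) := fun t ht =>
    (contDiff_slice_space h.smooth_u ht).continuous
  have hc2 : ∀ t ∈ Ico 0 T, ContDiff ℝ 2 (c t) := fun t ht =>
    (contDiff_slice_space h.smooth_c ht).of_le two_le_coe_top
  have hcc : ∀ t ∈ Ico 0 T, Continuous (c t) := fun t ht => (hc2 t ht).continuous
  have hcd : ∀ t ∈ Ico 0 T, Continuous (deriv (c t)) := fun t ht =>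
    (hc2 t ht).continuous_deriv (by norm_num)
  have hWρ : ∀ t ∈ Ico 0 T, Continuous fun x => W (ρ t x) := fun t ht =>
    hWcont.comp_continuous (hρc t ht) (h.rho_pos t)
  have henergy : ∀ t ∈ Ico 0 T, IntervalIntegrable (fun x => ρ t x * u t x ^ 2 / 2 + W (ρ t x) +
      γ / 2 * (c t x - ρ t x) ^ 2 + κ / 2 * deriv (c t) x ^ 2) volume 0 1 := fun t ht =>
    (((((hρc t ht).mul ((huc t ht).pow 2)).div_const 2).add (hWρ t ht)).add
      (continuous_const.mul (((hcc t ht).sub (hρc t ht)).pow 2))).add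
      (continuous_const.mul ((hcd t ht).pow 2)) |>.intervalIntegrable 0 1
  have h0 : (0 : ℝ) ∈ Ico 0 T := ⟨le_rfl, hT⟩
  have hu₀ : L2norm u₀ ^ 2 = ∫ x in (0 : ℝ)..1, u 0 x ^ 2 := by
    simp_rw [h.init_u]
    exact Real.sq_sqrt (intervalIntegral.integral_nonneg zero_le_one fun x _ => sq_nonneg _)
  have hK : ∀ x, W (ρ 0 x) ≤ K W M₀ := by
    intro x
    rw [h.init_rho]
    refine le_csSup (isCompact_Icc.bddAbove_image (hWcont.mono fun r hr =>
      (inv_pos.2 hM).trans_le hr.1)) ⟨_, hinit x, rfl⟩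
  have hρ0 : ∀ x, ρ 0 x ≤ M₀ := fun x => h.init_rho x ▸ (hinit x).2
  have hell := elliptic_energy_le hγ hκ (hρc 0 h0) (hc2 0 h0) (h.periodic_c 0) (h.elliptic 0 h0)
  have hρsq : ∫ x in (0 : ℝ)..1, ρ 0 x ^ 2 ≤ M₀ ^ 2 := by
    have := intervalIntegral.integral_mono_on (f := fun x => ρ 0 x ^ 2) (g := fun _ => M₀ ^ 2)
      (μ := volume) zero_le_one (((hρc 0 h0).pow 2).intervalIntegrable 0 1) (by simp) fun x _ =>
        pow_le_pow_left₀ (h.rho_pos 0 x).le (hρ0 x) 2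
    simpa using this
  have hE0 : ∫ x in (0 : ℝ)..1, (ρ 0 x * u 0 x ^ 2 / 2 + W (ρ 0 x) +
      γ / 2 * (c 0 x - ρ 0 x) ^ 2 + κ / 2 * deriv (c 0) x ^ 2) ≤
      M₀ * L2norm u₀ ^ 2 / 2 + K W M₀ + γ / 2 * M₀ ^ 2 := by
    have d1 := hρc 0 h0
    have d2 := huc 0 h0
    have d3 := hcc 0 h0
    have d4 := hcd 0 h0
    have hle : ∫ x in (0 : ℝ)..1, (ρ 0 x * u 0 x ^ 2 / 2 + W (ρ 0 x) +
        γ / 2 * (c 0 x - ρ 0 x) ^ 2 + κ / 2 * deriv (c 0) x ^ 2) ≤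
        ∫ x in (0 : ℝ)..1, (M₀ / 2 * u 0 x ^ 2 + K W M₀ +
          γ / 2 * (c 0 x - ρ 0 x) ^ 2 + κ / 2 * deriv (c 0) x ^ 2) := by
      refine intervalIntegral.integral_mono_on zero_le_one
        (henergy 0 h0) (Continuous.intervalIntegrable (by fun_prop) 0 1) fun x _ => ?_
      have := mul_le_mul_of_nonneg_right (hρ0 x) (sq_nonneg (u 0 x))
      linarith [hK x]
    refine hle.trans ?_
    rw [intervalIntegral.integral_add (Continuous.intervalIntegrable (by fun_prop) 0 1)
        (Continuous.intervalIntegrable (by fun_prop) 0 1),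
      intervalIntegral.integral_add (Continuous.intervalIntegrable (by fun_prop) 0 1)
        (Continuous.intervalIntegrable (by fun_prop) 0 1),
      intervalIntegral.integral_add (Continuous.intervalIntegrable (by fun_prop) 0 1)
        (by simp)]
    simp only [intervalIntegral.integral_const_mul, intervalIntegral.integral_const, sub_zero,
      one_smul, ← hu₀]
    nlinarith [mul_le_mul_of_nonneg_left hρsq hγ.le]
  have hX : ∀ t ∈ Ico 0 T, ∫ x in (0 : ℝ)..1, ρ t x ^ 2 ≤ X M₀ (L2norm u₀) γ W := by
    intro t ht
    have d1 := hρc t ht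
    have hen := (h.energy_le hμ hP hW ht).trans hE0
    have hle : ∫ x in (0 : ℝ)..1, ((q W).1 * ρ t x ^ 2 - (q W).2) ≤
        ∫ x in (0 : ℝ)..1, (ρ t x * u t x ^ 2 / 2 + W (ρ t x) +
          γ / 2 * (c t x - ρ t x) ^ 2 + κ / 2 * deriv (c t) x ^ 2) := by
      refine intervalIntegral.integral_mono_on zero_le_one
        (Continuous.intervalIntegrable (by fun_prop) 0 1) (henergy t ht) fun x _ => ?_
      have p1 := hlow _ (h.rho_pos t x)
      have p2 := h.rho_pos t x
      have p3 : 0 ≤ ρ t x * u t x ^ 2 / 2 + γ / 2 * (c t x - ρ t x) ^ 2 +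
        κ / 2 * deriv (c t) x ^ 2 := by positivity
      linarith
    rw [intervalIntegral.integral_sub (Continuous.intervalIntegrable (by fun_prop) 0 1)
      (by simp)] at hle
    simp only [intervalIntegral.integral_const_mul, intervalIntegral.integral_const, sub_zero,
      one_smul] at hle
    rw [le_div_iff₀ hδ]
    linarith
  have hX0 : 0 ≤ X M₀ (L2norm u₀) γ W :=
    (intervalIntegral.integral_nonneg zero_le_one fun x _ => sq_nonneg (ρ 0 x)).trans (hX 0 h0)
  refine ⟨by positivity, fun t ht => ?_⟩
  exact norms_le_of_integral_sq_le hγ hκ (hρc t ht) (hc2 t ht) (h.periodic_c t) (h.elliptic t ht)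
    (hX t ht)
end
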